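/- arXiv:2007.07305 — 2 statements merged into one kernel-verified Lean document; each statement's English description precedes it below -/
import Mathlib

section
/- Let k be a field of characteristic p and E an elementary abelian p-group of p-rank at least 2. Then the product of any two elements of negative degree in the Tate cohomology ring Ĥ*(E, k) is zero. -/
open MonoidAlgebra

theorem higman_exists {k G P : Type} [Field k] [CommGroup G] [Fintype G] [AddCommGroup P]
    [Module k P] [Module (MonoidAlgebra k G) P] [IsScalarTower k (MonoidAlgebra k G) P]
    [Module.Projective (MonoidAlgebra k G) P] :
    ∃ θ : P →ₗ[k] P, ∀ x, ∑ g : G, (single g⁻¹ (1 : k) : MonoidAlgebra k G) •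
      θ ((single g (1 : k) : MonoidAlgebra k G) • x) = x := by
  obtain ⟨s, hs⟩ := Module.projective_def'.1 (inferInstance : Module.Projective (MonoidAlgebra k G) P)
  let E : MonoidAlgebra k G →ₗ[k] MonoidAlgebra k G :=
    { toFun := fun r => single 1 (r.coeff 1)
      map_add' := by intro x y; simp [single_add]
      map_smul' := by intro c x; simp [smul_single] }
  have hEa : ∀ r, E r = single 1 (r.coeff 1) := fun _ => rfl
  have hE : ∀ r : MonoidAlgebra k G, ∑ g : G, (single g⁻¹ (1 : k) : MonoidAlgebra k G) *
      E ((single g (1 : k) : MonoidAlgebra k G) * r) = r := by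
    intro r
    ext h
    classical
    simp only [hEa, coeff_sum, Finset.sum_apply', single_mul_single, coeff_single_mul_apply]
    rw [Finset.sum_eq_single h⁻¹]
    · simp
    · intro b _ hb
      have : b⁻¹ ≠ h := fun hh => hb (by rw [← hh, inv_inv])
      simp [coeff_single, this]
    · simp
  let Φ : (P →₀ MonoidAlgebra k G) →ₗ[MonoidAlgebra k G] P :=
    Finsupp.linearCombination (MonoidAlgebra k G) id
  refine ⟨(Φ.restrictScalars k) ∘ₗ (Finsupp.mapRange.linearMap E) ∘ₗ (s.restrictScalars k), ?_⟩
  intro x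
  simp only [LinearMap.comp_apply, LinearMap.restrictScalars_apply, map_smul]
  have key : ∑ g : G, (single g⁻¹ (1 : k) : MonoidAlgebra k G) • (Finsupp.mapRange.linearMap E)
      ((single g (1 : k) : MonoidAlgebra k G) • (s x)) = s x := by
    ext1 y
    rw [Finset.sum_apply']
    simpa using hE (s x y)
  simp only [← map_smul, ← map_sum]
  have h2 : Φ (s x) = x := LinearMap.congr_fun hs x
  conv_rhs => rw [← h2, ← key]
  simp

theorem higman_projective {k G P : Type} [Field k] [CommGroup G] [Fintype G] [AddCommGroup P]
    [Module k P] [Module (MonoidAlgebra k G) P] [IsScalarTower k (MonoidAlgebra k G) P]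
    (θ : P →ₗ[k] P) (hθ : ∀ x, ∑ g : G, (single g⁻¹ (1 : k) : MonoidAlgebra k G) •
      θ ((single g (1 : k) : MonoidAlgebra k G) • x) = x) :
    Module.Projective (MonoidAlgebra k G) P := by
  refine Module.Projective.of_lifting_property'' fun f hf => ?_
  obtain ⟨l, hl⟩ := Module.projective_lifting_property (f.restrictScalars k) (LinearMap.id : P →ₗ[k] P) hf
  refine ⟨(l ∘ₗ θ).sumOfConjugatesEquivariant G, ?_⟩
  ext x
  have hl' : ∀ x, f (l x) = x := fun x => LinearMap.congr_fun hl x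
  simp [LinearMap.sumOfConjugatesEquivariant, LinearMap.sumOfConjugates_apply, LinearMap.conjugate_apply, hl', hθ]

theorem higman_injective {k G P : Type} [Field k] [CommGroup G] [Fintype G] [AddCommGroup P]
    [Module k P] [Module (MonoidAlgebra k G) P] [IsScalarTower k (MonoidAlgebra k G) P]
    (θ : P →ₗ[k] P) (hθ : ∀ x, ∑ g : G, (single g⁻¹ (1 : k) : MonoidAlgebra k G) •
      θ ((single g (1 : k) : MonoidAlgebra k G) • x) = x) :
    Module.Injective (MonoidAlgebra k G) P := by
  constructor
  intro X Y _ _ _ _ f hf g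
  let _ : Module k X := Module.compHom X (algebraMap k (MonoidAlgebra k G))
  let _ : Module k Y := Module.compHom Y (algebraMap k (MonoidAlgebra k G))
  have : IsScalarTower k (MonoidAlgebra k G) X := IsScalarTower.of_algebraMap_smul fun _ _ => rfl
  have : IsScalarTower k (MonoidAlgebra k G) Y := IsScalarTower.of_algebraMap_smul fun _ _ => rfl
  obtain ⟨j, hj⟩ := (f.restrictScalars k).exists_leftInverse_of_injective (LinearMap.ker_eq_bot.2 hf)
  have hj' : ∀ x, j (f x) = x := fun x => LinearMap.congr_fun hj x
  refine ⟨(θ ∘ₗ (g.restrictScalars k) ∘ₗ j).sumOfConjugatesEquivariant G, fun x => ?_⟩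
  rw [LinearMap.sumOfConjugatesEquivariant_apply]
  have : ∀ a : G, (θ ∘ₗ (g.restrictScalars k) ∘ₗ j).conjugate a (f x) =
      (single a⁻¹ (1 : k) : MonoidAlgebra k G) • θ ((single a (1 : k) : MonoidAlgebra k G) • g x) := by
    intro a
    rw [LinearMap.conjugate_apply, ← map_smul f]
    simp only [LinearMap.comp_apply, hj', LinearMap.restrictScalars_apply, map_smul g]
  simp only [this, hθ]

theorem glue_graded {R M M' : Type} [Ring R] [AddCommGroup M] [Module R M] [AddCommGroup M']
    [Module R M'] (S : ℤ → Submodule R M) (hGrad : DirectSum.IsInternal S)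
    (φ : ∀ i, S i →ₗ[R] M') :
    ∃ Φ : M →ₗ[R] M', ∀ i, ∀ x (hx : x ∈ S i), Φ x = φ i ⟨x, hx⟩ := by
  classical
  let e := LinearEquiv.ofBijective (DirectSum.coeLinearMap S) hGrad
  refine ⟨(DirectSum.toModule R ℤ M' φ) ∘ₗ e.symm.toLinearMap, fun i x hx => ?_⟩
  have : e (DirectSum.lof R ℤ (fun i => S i) i ⟨x, hx⟩) = x :=
    DirectSum.coeLinearMap_lof S i ⟨x, hx⟩
  have h2 : e.symm x = DirectSum.lof R ℤ (fun i => S i) i ⟨x, hx⟩ := by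
    rw [LinearEquiv.symm_apply_eq, this]
  simp only [LinearMap.comp_apply, LinearEquiv.coe_coe, h2]
  rw [DirectSum.toModule_lof]

theorem lift_one {R P M' X : Type} [Ring R] [AddCommGroup P] [Module R P] [AddCommGroup M']
    [Module R M'] [AddCommGroup X] [Module R X] [Module.Projective R P]
    (A : Submodule R M') (D : M' →ₗ[R] X) (φ : P →ₗ[R] X) (h : ∀ x, ∃ y ∈ A, D y = φ x) :
    ∃ l : P →ₗ[R] M', (∀ x, l x ∈ A) ∧ ∀ x, D (l x) = φ x := by
  let D' : A →ₗ[R] (A.map D) := (D ∘ₗ A.subtype).codRestrict (A.map D)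
    (fun x => ⟨x, x.2, rfl⟩)
  let φ' : P →ₗ[R] (A.map D) := φ.codRestrict (A.map D) (fun x => by
    obtain ⟨y, hy, e⟩ := h x
    exact ⟨y, hy, e⟩)
  have hs : Function.Surjective D' := by
    rintro ⟨_, y, hy, rfl⟩
    exact ⟨⟨y, hy⟩, rfl⟩
  obtain ⟨l, hl⟩ := Module.projective_lifting_property D' φ' hs
  refine ⟨A.subtype ∘ₗ l, fun x => (l x).2, fun x => ?_⟩
  have := congrArg Subtype.val (LinearMap.congr_fun hl x)
  exact this

theorem lift_up {R M M' : Type} [Ring R] [AddCommGroup M] [Module R M] [AddCommGroup M']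
    [Module R M'] (S : ℤ → Submodule R M) (hGrad : DirectSum.IsInternal S)
    (hproj : ∀ i, Module.Projective R (S i)) (d : M →ₗ[R] M) (hd2 : ∀ x, d (d x) = 0)
    (hdeg : ∀ (i : ℤ), ∀ x ∈ S i, d x ∈ S (i - 1))
    (A : ℤ → Submodule R M') (D : M' →ₗ[R] M')
    (hex : ∀ i : ℤ, 0 ≤ i → ∀ z ∈ A i, D z = 0 → ∃ y ∈ A (i + 1), D y = z)
    (U : M →ₗ[R] M') (hU : ∀ i : ℤ, 0 ≤ i → ∀ x ∈ S i, U x ∈ A i)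
    (hUD : ∀ i : ℤ, 1 ≤ i → ∀ x ∈ S i, D (U x) = U (d x))
    (s0 : M →ₗ[R] M') (hs0 : ∀ x ∈ S (-1), s0 x ∈ A 0)
    (hs0D : ∀ x ∈ S 0, D (U x - s0 (d x)) = 0) :
    ∃ s : M →ₗ[R] M', (∀ i : ℤ, i < 0 → ∀ x ∈ S i, s x = s0 x) ∧
      (∀ i : ℤ, 0 ≤ i → ∀ x ∈ S i, s x ∈ A (i + 1)) ∧
      ∀ i : ℤ, 0 ≤ i → ∀ x ∈ S i, D (s x) + s (d x) = U x := by
  have step : ∀ n : ℕ, ∀ τ : M →ₗ[R] M',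
      ((∀ x ∈ S ((n : ℤ) - 1), τ x ∈ A n) ∧ ∀ x ∈ S n, D (U x - τ (d x)) = 0) →
      ∃ τ' : M →ₗ[R] M', ((∀ x ∈ S (((n + 1 : ℕ) : ℤ) - 1), τ' x ∈ A (n + 1 : ℕ)) ∧
        ∀ x ∈ S (n + 1 : ℕ), D (U x - τ' (d x)) = 0) ∧
        ∀ x ∈ S n, D (τ' x) + τ (d x) = U x := by
    intro n τ ⟨h1, h2⟩
    have := hproj n
    obtain ⟨l, hl, hl2⟩ := lift_one (A ((n : ℤ) + 1)) D ((U - τ ∘ₗ d) ∘ₗ (S n).subtype) (by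
      rintro ⟨x, hx⟩
      refine hex n (by positivity) _ ?_ (h2 x hx)
      exact (A n).sub_mem (hU n (by positivity) x hx) (h1 _ (hdeg n x hx)))
    obtain ⟨τ', hτ'⟩ := glue_graded S hGrad
      (fun i => if h : i = (n : ℤ) then (l ∘ₗ (LinearEquiv.ofEq _ _ (by rw [h])).toLinearMap : S i →ₗ[R] M') else 0)
    have hτ : ∀ x (hx : x ∈ S n), τ' x = l ⟨x, hx⟩ := by
      intro x hx
      rw [hτ' n x hx, dif_pos rfl]
      rfl
    have h3 : ∀ x ∈ S n, D (τ' x) + τ (d x) = U x := by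
      intro x hx
      rw [hτ x hx, hl2]
      simp
    refine ⟨τ', ⟨?_, ?_⟩, h3⟩
    · intro x hx
      push_cast at hx ⊢
      rw [add_sub_cancel_right] at hx
      rw [hτ x hx]
      exact hl _
    · intro x hx
      have hdx : d x ∈ S n := by
        have := hdeg _ x hx
        push_cast at this
        rwa [add_sub_cancel_right] at this
      have := h3 _ hdx
      rw [hd2, map_zero, add_zero] at this
      rw [map_sub, this, hUD _ (by push_cast; omega) x hx, sub_self]
  choose! F hF1 hF2 using step
  let t : ℕ → (M →ₗ[R] M') := fun n => Nat.rec s0 (fun n τ => F n τ) n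
  have ht0 : t 0 = s0 := rfl
  have ht : ∀ n : ℕ, ((∀ x ∈ S ((n : ℤ) - 1), t n x ∈ A n) ∧
      ∀ x ∈ S n, D (U x - t n (d x)) = 0) := by
    intro n
    induction n with
    | zero => exact ⟨by simpa [ht0] using hs0, by simpa [ht0] using hs0D⟩
    | succ n ih => exact hF1 n (t n) ih
  have ht2 : ∀ n : ℕ, ∀ x ∈ S n, D (t (n + 1) x) + t n (d x) = U x :=
    fun n => hF2 n (t n) (ht n)
  obtain ⟨s, hs⟩ := glue_graded S hGrad (fun i => (t (i + 1).toNat) ∘ₗ (S i).subtype)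
  have hs' : ∀ i : ℤ, ∀ x ∈ S i, s x = t (i + 1).toNat x := fun i x hx => hs i x hx
  refine ⟨s, ?_, ?_, ?_⟩
  · intro i hi x hx
    rw [hs' i x hx, Int.toNat_of_nonpos (by omega), ht0]
  · intro i hi x hx
    rw [hs' i x hx]
    have := (ht (i + 1).toNat).1 x
    rw [Int.toNat_of_nonneg (by omega), add_sub_cancel_right] at this
    exact this hx
  · intro i hi x hx
    rw [hs' i x hx, hs' _ _ (hdeg i x hx)]
    lift i to ℕ using hi
    have := ht2 i x hx
    simpa using this

theorem extend_one {R M : Type} [Ring R] [AddCommGroup M] [Module R M]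
    (F X : Submodule R M) [Module.Injective R F] (D : M →ₗ[R] M) (w : M →ₗ[R] M)
    (hw : ∀ x ∈ X, w x ∈ F) (hD : ∀ x ∈ X, D x = 0 → w x = 0) :
    ∃ τ : M →ₗ[R] M, (∀ y, τ y ∈ F) ∧ ∀ x ∈ X, τ (D x) = w x := by
  let D' : X →ₗ[R] M := D ∘ₗ X.subtype
  let w' : X →ₗ[R] F := (w ∘ₗ X.subtype).codRestrict F (fun x => hw x x.2)
  have hk : LinearMap.ker D' ≤ LinearMap.ker w' := by
    intro x hx
    rw [LinearMap.mem_ker] at hx ⊢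
    exact Subtype.ext (hD x x.2 hx)
  obtain ⟨τ, hτ⟩ := Module.Injective.out ((LinearMap.ker D').liftQ D' le_rfl)
    (LinearMap.ker_eq_bot.1 (Submodule.ker_liftQ_eq_bot _ _ _ le_rfl))
    ((LinearMap.ker D').liftQ w' hk)
  refine ⟨F.subtype ∘ₗ τ, fun y => (τ y).2, fun x hx => ?_⟩
  have := hτ (Submodule.Quotient.mk ⟨x, hx⟩)
  simp only [Submodule.liftQ_apply] at this
  exact congrArg Subtype.val this

theorem down_up {R M : Type} [Ring R] [AddCommGroup M] [Module R M]
    (S : ℤ → Submodule R M) (hGrad : DirectSum.IsInternal S)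
    (hproj : ∀ i, Module.Projective R (S i)) (hinj : ∀ i, Module.Injective R (S i))
    (d : M →ₗ[R] M) (hd2 : ∀ x, d (d x) = 0)
    (hdeg : ∀ (i : ℤ), ∀ x ∈ S i, d x ∈ S (i - 1))
    (hexact : ∀ (i : ℤ), ∀ x ∈ S i, d x = 0 → ∃ y ∈ S (i + 1), d y = x)
    (n : ℤ) (h : M →ₗ[R] M) (hh : ∀ x, h (d x) = d (h x))
    (hhdeg : ∀ (i : ℤ), ∀ x ∈ S i, h x ∈ S (i + n))
    (w : M →ₗ[R] M) (hw : ∀ x ∈ S 0, w x ∈ S n) (hw0 : ∀ x ∈ S 0, d x = 0 → w x = 0)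
    (hwd : ∀ x ∈ S 0, d (w x) = h (d x)) :
    ∃ s : M →ₗ[R] M, (∀ i : ℤ, ∀ x ∈ S i, s x ∈ S (i + n + 1)) ∧
      ∀ x, h x = d (s x) + s (d x) := by
  have := hinj
  obtain ⟨τ0, h1, h2⟩ := extend_one (S n) (S 0) d w hw hw0
  have step : ∀ m : ℕ, ∀ τ : M →ₗ[R] M,
      ((∀ y, τ y ∈ S (n - m)) ∧ ∀ x ∈ S (- (m : ℤ) - 1), d x = 0 → h x = d (τ x)) →
      ∃ τ' : M →ₗ[R] M, ((∀ y, τ' y ∈ S (n - (m + 1 : ℕ))) ∧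
        ∀ x ∈ S (- ((m + 1 : ℕ) : ℤ) - 1), d x = 0 → h x = d (τ' x)) ∧
        ∀ x ∈ S (- (m : ℤ) - 1), h x = d (τ x) + τ' (d x) := by
    intro m τ ⟨a1, a2⟩
    obtain ⟨τ', b1, b2⟩ := extend_one (S (n - (m + 1 : ℕ))) (S (- (m : ℤ) - 1)) d (h - d ∘ₗ τ)
      (by
        intro x hx
        refine Submodule.sub_mem _ ?_ ?_
        · have := hhdeg _ x hx
          convert this using 2
          push_cast; ring
        · have := hdeg _ _ (a1 x)
          rw [LinearMap.comp_apply]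
          convert this using 2
          push_cast; ring)
      (by
        intro x hx hdx
        simp [a2 x hx hdx])
    have b3 : ∀ x ∈ S (- (m : ℤ) - 1), h x = d (τ x) + τ' (d x) := by
      intro x hx
      rw [b2 x hx]; simp
    refine ⟨τ', ⟨b1, ?_⟩, b3⟩
    intro x hx hdx
    obtain ⟨y, hy, rfl⟩ := hexact _ x hx hdx
    have hy' : y ∈ S (- (m : ℤ) - 1) := by
      convert hy using 2
      push_cast; ring
    rw [hh, b3 y hy', map_add, hd2, zero_add]
  choose! F hF1 hF2 using step
  let t : ℕ → (M →ₗ[R] M) := fun n => Nat.rec τ0 (fun n τ => F n τ) n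
  have ht0 : t 0 = τ0 := rfl
  have ht : ∀ m : ℕ, ((∀ y, t m y ∈ S (n - m)) ∧
      ∀ x ∈ S (- (m : ℤ) - 1), d x = 0 → h x = d (t m x)) := by
    intro m
    induction m with
    | zero =>
      refine ⟨by simpa [ht0] using h1, ?_⟩
      intro x hx hdx
      obtain ⟨y, hy, rfl⟩ := hexact _ x hx hdx
      have hy' : y ∈ S 0 := by
        convert hy using 2
        simp
      rw [← hwd y hy', ← h2 y hy']
      rfl
    | succ n ih => exact hF1 n (t n) ih
  have ht2 : ∀ m : ℕ, ∀ x ∈ S (- (m : ℤ) - 1), h x = d (t m x) + t (m + 1) (d x) :=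
    fun m => hF2 m (t m) (ht m)
  obtain ⟨s0, hs0⟩ := glue_graded S hGrad (fun i => (t (- i - 1).toNat) ∘ₗ (S i).subtype)
  have hs0' : ∀ i : ℤ, ∀ x ∈ S i, s0 x = t (- i - 1).toNat x := fun i x hx => hs0 i x hx
  obtain ⟨s, hs, hs2, hs3⟩ := lift_up S hGrad hproj d hd2 hdeg (fun i => S (i + n)) d
    (by
      intro i _ z hz hdz
      obtain ⟨y, hy, e⟩ := hexact _ z hz hdz
      exact ⟨y, by convert hy using 2; ring, e⟩)
    h (fun i _ x hx => hhdeg i x hx) (fun i _ x hx => (hh x).symm) s0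
    (by
      intro x hx
      rw [hs0' _ x hx]
      simpa using (ht 0).1 x)
    (by
      intro x hx
      rw [map_sub, hs0' _ _ (hdeg 0 x hx)]
      have : t (-(0 - 1) - 1 : ℤ).toNat (d x) = w x := h2 x hx
      rw [this, hwd x hx, hh, sub_self])
  have hA : ∀ i : ℤ, ∀ x ∈ S i, s x ∈ S (i + n + 1) := by
    intro i x hx
    rcases lt_or_ge i 0 with hi | hi
    · rw [hs i hi x hx, hs0' i x hx]
      have := (ht (- i - 1).toNat).1 x
      rw [Int.toNat_of_nonneg (by omega)] at this
      convert this using 2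
      ring
    · have := hs2 i hi x hx
      convert this using 2
      ring
  have hB : ∀ i : ℤ, ∀ x ∈ S i, h x = d (s x) + s (d x) := by
    intro i x hx
    rcases lt_or_ge i 0 with hi | hi
    · have h4 := hdeg i x hx
      rw [hs i hi x hx, hs _ (by omega) _ h4, hs0' _ _ hx, hs0' _ _ h4]
      obtain ⟨m, rfl⟩ : ∃ m : ℕ, i = - (m : ℤ) - 1 := ⟨(- i - 1).toNat, by omega⟩
      have e1 : (-(-(m : ℤ) - 1) - 1).toNat = m := by omega
      have e2 : (-(-(m : ℤ) - 1 - 1) - 1).toNat = m + 1 := by omega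
      rw [e1, e2]
      exact ht2 m x hx
    · exact (hs3 i hi x hx).symm
  refine ⟨s, hA, ?_⟩
  have htop : ∀ x : M, x ∈ ⨆ i, S i := by
    intro x
    rw [DirectSum.IsInternal.submodule_iSup_eq_top hGrad]
    trivial
  intro x
  refine Submodule.iSup_induction S (motive := fun x => h x = d (s x) + s (d x)) (htop x) hB
    (by simp) ?_
  intro x y hx hy
  simp only [map_add, hx, hy]
  abel

/-- The key vanishing: a chain map of positive degree acts as zero on `N P`. -/
theorem key_vanish {R M Q : Type} [CommRing R] [AddCommGroup M] [Module R M] [AddCommGroup Q]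
    [Module R Q] (S : ℤ → Submodule R M) (hGrad : DirectSum.IsInternal S)
    (hproj : ∀ i, Module.Projective R (S i))
    (d : M →ₗ[R] M) (hd2 : ∀ x, d (d x) = 0)
    (hdeg : ∀ (i : ℤ), ∀ x ∈ S i, d x ∈ S (i - 1))
    (hexact : ∀ (i : ℤ), ∀ x ∈ S i, d x = 0 → ∃ y ∈ S (i + 1), d y = x)
    (B : ℤ → Submodule R Q) (dQ : Q →ₗ[R] Q) (π : M →ₗ[R] Q)
    (u v : R) (hu : u * u = 0)
    (hE : ∀ i : ℤ, 0 ≤ i → ∀ z ∈ S i, ∀ q ∈ B (i + 1), d (u • z) = 0 → π (u • z) = dQ (u • q) →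
      ∃ z' ∈ S (i + 1), ∃ q' ∈ B (i + 2), d (u • z') = u • z ∧ π (u • z') - dQ (u • q') = u • q)
    (hπN : ∀ i : ℤ, 0 ≤ i → ∀ x ∈ S i, π ((v * u) • x) = 0)
    (a : ℤ) (ha : 0 < a) (f : M →ₗ[R] M) (hf : ∀ x, f (d x) = d (f x))
    (hfdeg : ∀ (i : ℤ), ∀ x ∈ S i, f x ∈ S (i + a))
    (hf0 : ∀ x ∈ S 0, ∃ m ∈ S (a - 1), f (d x) = (v * u) • m)
    (j : ℤ) (hj : 0 ≤ j) (m : M) (hm : m ∈ S j) (hdm : d ((v * u) • m) = 0) :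
    ∃ w ∈ S (j + a + 1), f ((v * u) • m) = d ((v * u) • w) := by
  -- the cone
  let A : ℤ → Submodule R (M × Q) := fun i =>
    ((S (i + a - 1)).map (LinearMap.lsmul R M u)).prod ((B (i + a)).map (LinearMap.lsmul R Q u))
  have hA : ∀ i z, z ∈ A i ↔ (∃ y ∈ S (i + a - 1), u • y = z.1) ∧ ∃ y ∈ B (i + a), u • y = z.2 := by
    intro i z
    simp [A, Submodule.mem_prod]
  let D : (M × Q) →ₗ[R] (M × Q) :=
    -((d ∘ₗ LinearMap.fst R M Q).prod (π ∘ₗ LinearMap.fst R M Q - dQ ∘ₗ LinearMap.snd R M Q))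
  have hD : ∀ z, D z = (- d z.1, - (π z.1 - dQ z.2)) := fun z => rfl
  obtain ⟨U, hU⟩ := glue_graded S hGrad (M' := M × Q) (fun i =>
    if i = 0 then (LinearMap.inl R M Q) ∘ₗ (-(f ∘ₗ d)) ∘ₗ (S i).subtype else 0)
  have hU0 : ∀ x ∈ S 0, U x = (- f (d x), 0) := by
    intro x hx
    rw [hU 0 x hx, if_pos rfl]
    rfl
  have hU1 : ∀ i : ℤ, i ≠ 0 → ∀ x ∈ S i, U x = 0 := by
    intro i hi x hx
    rw [hU i x hx, if_neg hi]
    rfl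
  obtain ⟨s, hs1, hs2, hs3⟩ := lift_up S hGrad hproj d hd2 hdeg A D
    (by
      rintro i hi ⟨z, q⟩ hzq hDz
      obtain ⟨⟨z, hz, rfl⟩, ⟨q, hq, rfl⟩⟩ := (hA _ _).1 hzq
      rw [hD, Prod.mk_eq_zero, neg_eq_zero, neg_eq_zero, sub_eq_zero] at hDz
      obtain ⟨z', hz', q', hq', e1, e2⟩ := hE (i + a - 1) (by omega) z hz q
        (by convert hq using 2; ring) hDz.1 hDz.2
      refine ⟨(u • (-z'), u • (-q')), (hA _ _).2 ⟨⟨-z', ?_, rfl⟩, ⟨-q', ?_, rfl⟩⟩, ?_⟩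
      · refine neg_mem ?_
        convert hz' using 2
        ring
      · refine neg_mem ?_
        convert hq' using 2
        ring
      · rw [hD]
        simp only [smul_neg, map_neg, neg_neg, e1]
        rw [← e2]
        congr 1
        abel)
    U
    (by
      intro i hi x hx
      rcases eq_or_ne i 0 with rfl | h
      · rw [hU0 x hx, hA]
        obtain ⟨m, hm, e⟩ := hf0 x hx
        refine ⟨⟨- (v • m), neg_mem (Submodule.smul_mem _ _ ?_), ?_⟩, ⟨0, zero_mem _, smul_zero _⟩⟩
        · convert hm using 2
          ring
        · simp only [e, smul_neg, smul_smul, mul_comm]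
      · rw [hU1 i h x hx]
        exact zero_mem _)
    (by
      intro i hi x hx
      rw [hU1 i (by omega) x hx, map_zero]
      rcases eq_or_ne i 1 with rfl | h
      · rw [hU0 (d x) (hdeg _ x hx), hd2, map_zero, neg_zero]
        rfl
      · rw [hU1 (i - 1) (by omega) _ (hdeg _ x hx)])
    0 (fun x hx => by simp)
    (by
      intro x hx
      rw [LinearMap.zero_apply, sub_zero, hU0 x hx, hD]
      obtain ⟨m, hm, e⟩ := hf0 x hx
      simp only [map_neg, neg_neg, map_zero, sub_zero]
      rw [← hf, hd2, map_zero, e, hπN _ (by omega) m hm]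
      rfl)
  let f' : M →ₗ[R] M := LinearMap.fst R M Q ∘ₗ s
  have hf'1 : ∀ i : ℤ, 0 ≤ i → ∀ x ∈ S i, ∃ y ∈ S (i + a), u • y = f' x := by
    intro i hi x hx
    obtain ⟨y, hy, e⟩ := ((hA _ _).1 (hs2 i hi x hx)).1
    exact ⟨y, by convert hy using 2; ring, e⟩
  have hf'2 : ∀ x ∈ S 0, d (f' x) = f (d x) := by
    intro x hx
    have h1 := hs3 0 le_rfl x hx
    rw [hs1 _ (by omega) _ (hdeg _ x hx), hU0 x hx, hD] at h1
    have := congrArg Prod.fst h1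
    have h2 : - d (f' x) + 0 = - f (d x) := this
    rwa [add_zero, neg_inj] at h2
  have hf'3 : ∀ i : ℤ, 1 ≤ i → ∀ x ∈ S i, d (f' x) = f' (d x) := by
    intro i hi x hx
    have h1 := hs3 i (by omega) x hx
    rw [hU1 i (by omega) x hx, hD] at h1
    have := congrArg Prod.fst h1
    simp only [Prod.fst_add, Prod.fst_zero] at this
    rw [neg_add_eq_zero] at this
    exact this
  obtain ⟨η, -, hη2, hη3⟩ := lift_up S hGrad hproj d hd2 hdeg (fun i => S (i + a)) d
    (by
      intro i _ z hz hdz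
      obtain ⟨y, hy, e⟩ := hexact _ z hz hdz
      exact ⟨y, by convert hy using 2; ring, e⟩)
    (f - f')
    (by
      intro i hi x hx
      refine Submodule.sub_mem _ (hfdeg i x hx) ?_
      obtain ⟨y, hy, e⟩ := hf'1 i hi x hx
      rw [← e]
      exact Submodule.smul_mem _ _ hy)
    (by
      intro i hi x hx
      simp only [LinearMap.sub_apply, map_sub, hf, hf'3 i hi x hx])
    0 (fun x hx => by simp)
    (by
      intro x hx
      simp only [LinearMap.sub_apply, map_sub, hf'2 x hx, hf, LinearMap.zero_apply, sub_zero, sub_self])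
  refine ⟨η m, by convert hη2 j hj m hm using 2; ring, ?_⟩
  have h1 := hη3 j hj _ (Submodule.smul_mem _ (v * u) hm)
  obtain ⟨y, hy, e⟩ := hf'1 j hj m hm
  have h2 : f' ((v * u) • m) = 0 := by
    rw [map_smul, ← e, smul_smul, mul_assoc, hu, mul_zero, zero_smul]
  rw [hdm, map_zero, add_zero, LinearMap.sub_apply, h2, sub_zero] at h1
  rw [← h1, map_smul η]

theorem proj_restrict {k C H G M : Type} [Field k] [CommGroup C] [CommGroup H] [CommGroup G]
    [Fintype C] [Fintype H] [Fintype G] (e : C × H ≃* G) [AddCommGroup M] [Module k M]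
    [Module (MonoidAlgebra k G) M] [IsScalarTower k (MonoidAlgebra k G) M]
    [Module (MonoidAlgebra k H) M] [IsScalarTower k (MonoidAlgebra k H) M]
    (hc : ∀ (h : H) (x : M), (single h (1 : k) : MonoidAlgebra k H) • x =
      (single (e (1, h)) (1 : k) : MonoidAlgebra k G) • x)
    (S : Submodule (MonoidAlgebra k G) M) (S' : Submodule (MonoidAlgebra k H) M)
    (hSS : ∀ x, x ∈ S' ↔ x ∈ S) [Module.Projective (MonoidAlgebra k G) S] :
    Module.Projective (MonoidAlgebra k H) S' := by
  obtain ⟨θ, hθ⟩ := higman_exists (k := k) (G := G) (P := S)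
  let w : S' →ₗ[k] S :=
    { toFun := fun x => ⟨x, (hSS _).1 x.2⟩
      map_add' := fun _ _ => rfl
      map_smul' := fun _ _ => rfl }
  let w' : S →ₗ[k] S' :=
    { toFun := fun x => ⟨x, (hSS _).2 x.2⟩
      map_add' := fun _ _ => rfl
      map_smul' := fun _ _ => rfl }
  let θ' : S →ₗ[k] S := ∑ c : C, θ.conjugate (e (c, 1))
  have hθ' : ∀ x, θ' x = ∑ c : C, (single (e (c, 1))⁻¹ (1 : k) : MonoidAlgebra k G) •
      θ ((single (e (c, 1)) (1 : k) : MonoidAlgebra k G) • x) := by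
    intro x
    simp only [θ', LinearMap.sum_apply, LinearMap.conjugate_apply]
  refine higman_projective (w' ∘ₗ θ' ∘ₗ w) fun x => ?_
  have h1 : ∀ h : H, w ((single h (1 : k) : MonoidAlgebra k H) • x) =
      (single (e (1, h)) (1 : k) : MonoidAlgebra k G) • w x := by
    intro h
    exact Subtype.ext (hc h _)
  have h2 : ∀ (h : H) (y : S), (single h (1 : k) : MonoidAlgebra k H) • w' y =
      w' ((single (e (1, h)) (1 : k) : MonoidAlgebra k G) • y) := by
    intro h y
    exact Subtype.ext (hc h _)
  have h3 : ∑ h : H, (single (e (1, h⁻¹)) (1 : k) : MonoidAlgebra k G) •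
      θ' ((single (e (1, h)) (1 : k) : MonoidAlgebra k G) • w x) = w x := by
    conv_rhs => rw [← hθ (w x)]
    rw [← e.toEquiv.sum_comp, Fintype.sum_prod_type_right]
    refine Finset.sum_congr rfl fun h _ => ?_
    rw [hθ', Finset.smul_sum]
    refine Finset.sum_congr rfl fun c _ => ?_
    simp only [smul_smul, single_mul_single, one_mul, ← map_inv, ← map_mul, MulEquiv.toEquiv_eq_coe,
      MulEquiv.coe_toEquiv, Prod.mk_mul_mk, Prod.inv_mk, mul_one, inv_one]
  simp only [LinearMap.comp_apply, h1, h2, ← map_sum, h3]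
  rfl

theorem group_vanish {k C H G M Q : Type} [Field k] [CommGroup C] [CommGroup H] [CommGroup G]
    [Fintype C] [Fintype H] [Fintype G] (e : C × H ≃* G)
    (hC : (Fintype.card C : k) = 0) (hH : (Fintype.card H : k) = 0)
    [AddCommGroup M] [Module k M]
    [Module (MonoidAlgebra k G) M] [IsScalarTower k (MonoidAlgebra k G) M]
    [Module (MonoidAlgebra k H) M] [IsScalarTower k (MonoidAlgebra k H) M]
    (hc : ∀ (r : MonoidAlgebra k H) (x : M), r • x =
      (mapDomainRingHom k (e.toMonoidHom.comp (MonoidHom.inr C H)) r) • x)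
    [AddCommGroup Q] [Module (MonoidAlgebra k G) Q] (jj : Q ≃+ M)
    (hjj : ∀ (r : MonoidAlgebra k G) (q : Q), jj (r • q) =
      (mapDomainRingHom k ((MonoidHom.snd C H).comp e.symm.toMonoidHom) r) • jj q)
    (S : ℤ → Submodule (MonoidAlgebra k G) M) (hGrad : DirectSum.IsInternal S)
    (hproj : ∀ i, Module.Projective (MonoidAlgebra k G) (S i))
    (d : M →ₗ[MonoidAlgebra k G] M) (hd2 : ∀ x, d (d x) = 0)
    (hdeg : ∀ (i : ℤ), ∀ x ∈ S i, d x ∈ S (i - 1))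
    (hexact : ∀ (i : ℤ), ∀ x ∈ S i, d x = 0 → ∃ y ∈ S (i + 1), d y = x)
    (hinv : ∀ (g : G), ∀ x ∈ S 0, d ((single g (1 : k) : MonoidAlgebra k G) • x) = d x)
    (N : MonoidAlgebra k G) (hN : N = ∑ g : G, single g (1 : k))
    (a : ℤ) (ha : 0 < a) (f : M →ₗ[MonoidAlgebra k G] M) (hf : ∀ x, f (d x) = d (f x))
    (hfdeg : ∀ (i : ℤ), ∀ x ∈ S i, f x ∈ S (i + a))
    (hf0 : ∀ x ∈ S 0, ∃ m ∈ S (a - 1), f (d x) = N • m)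
    (j : ℤ) (hj : 0 ≤ j) (m : M) (hm : m ∈ S j) (hdm : d (N • m) = 0) :
    ∃ w ∈ S (j + a + 1), f (N • m) = d (N • w) := by
  have hc1 : ∀ (h : H) (x : M), (single h (1 : k) : MonoidAlgebra k H) • x =
      (single (e (1, h)) (1 : k) : MonoidAlgebra k G) • x := by
    intro h x
    rw [hc]
    simp
  have hj1 : ∀ (c : C) (h : H) (q : Q), jj ((single (e (c, h)) (1 : k) : MonoidAlgebra k G) • q) =
      (single h (1 : k) : MonoidAlgebra k H) • jj q := by
    intro c h q
    rw [hjj]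
    simp
  let S' : ℤ → Submodule (MonoidAlgebra k H) M := fun i =>
    { (S i).toAddSubmonoid with
      smul_mem' := by
        intro r x hx
        rw [hc]
        exact (S i).smul_mem _ hx }
  have hS' : ∀ i x, x ∈ S' i ↔ x ∈ S i := fun i x => Iff.rfl
  have hGrad' : DirectSum.IsInternal S' := hGrad
  have hproj' : ∀ i, Module.Projective (MonoidAlgebra k H) (S' i) := by
    intro i
    have := hproj i
    exact proj_restrict e hc1 (S i) (S' i) (hS' i)
  let d' : M →ₗ[MonoidAlgebra k H] M :=
    { toFun := d
      map_add' := d.map_add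
      map_smul' := by
        intro r x
        rw [hc, map_smul, RingHom.id_apply, hc] }
  let B : ℤ → Submodule (MonoidAlgebra k G) Q := fun i =>
    { carrier := {q | jj q ∈ S i}
      add_mem' := by
        intro x y hx hy
        simp only [Set.mem_ofPred_eq, map_add] at *
        exact add_mem hx hy
      zero_mem' := by simp
      smul_mem' := by
        intro r x hx
        simp only [Set.mem_ofPred_eq] at *
        rw [hjj]
        exact (S' i).smul_mem _ hx }
  have hB : ∀ i q, q ∈ B i ↔ jj q ∈ S i := fun i x => Iff.rfl
  let dQ : Q →ₗ[MonoidAlgebra k G] Q :=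
    { toFun := fun q => jj.symm (d (jj q))
      map_add' := by intro x y; simp
      map_smul' := by
        intro r x
        rw [RingHom.id_apply, AddEquiv.symm_apply_eq, hjj, hjj, AddEquiv.apply_symm_apply]
        exact d'.map_smul _ _ }
  have hdQ : ∀ q, jj (dQ q) = d (jj q) := fun q => jj.apply_symm_apply _
  let _ : Module k Q := Module.compHom Q (algebraMap k (MonoidAlgebra k G))
  have : IsScalarTower k (MonoidAlgebra k G) Q := IsScalarTower.of_algebraMap_smul fun _ _ => rfl
  have hjk : ∀ (c : k) q, jj (c • q) = c • jj q := by
    intro c q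
    have : c • q = (algebraMap k (MonoidAlgebra k G) c) • q := rfl
    rw [this, hjj, ← algebraMap_smul (MonoidAlgebra k H) c (jj q)]
    congr 1
    simp
  have hGH : ∀ g : G, ∃ c h, g = e (c, h) := fun g => ⟨(e.symm g).1, (e.symm g).2, by simp⟩
  -- the initial map
  let dz : S 0 →ₗ[k] Q :=
    { toFun := fun x => jj.symm (- d x)
      map_add' := by
        intro x y
        rw [← map_add]
        simp only [Submodule.coe_add, map_add, neg_add]
      map_smul' := by
        intro c x
        rw [RingHom.id_apply, AddEquiv.symm_apply_eq, hjk, AddEquiv.apply_symm_apply, smul_neg]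
        congr 1
        rw [← algebraMap_smul (MonoidAlgebra k G) c (d x), ← map_smul d, algebraMap_smul]
        rfl }
  have hdz : ∀ x, jj (dz x) = - d x := fun x => jj.apply_symm_apply _
  have hdinv : ∀ (h : H), ∀ x ∈ S 0, (single h (1 : k) : MonoidAlgebra k H) • d x = d x := by
    intro h x hx
    rw [hc1, ← map_smul, hinv _ x hx]
  let dz' : S 0 →ₗ[MonoidAlgebra k G] Q := equivariantOfLinearOfComm dz (by
    intro g x
    obtain ⟨c, h, rfl⟩ := hGH g
    apply jj.injective
    rw [hj1, hdz, hdz, smul_neg, hdinv h _ x.2]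
    exact congrArg Neg.neg (hinv _ _ x.2))
  have hdz' : ∀ x, jj (dz' x) = - d x := hdz
  obtain ⟨U, hU⟩ := glue_graded S hGrad (M' := Q) (fun i =>
    if h : i = 0 then dz' ∘ₗ (LinearEquiv.ofEq _ _ (by rw [h])).toLinearMap else 0)
  have hU0 : ∀ x ∈ S 0, jj (U x) = - d x := by
    intro x hx
    rw [hU 0 x hx, dif_pos rfl]
    exact hdz' _
  have hU1 : ∀ i : ℤ, i ≠ 0 → ∀ x ∈ S i, U x = 0 := by
    intro i hi x hx
    rw [hU i x hx, dif_neg hi]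
    rfl
  obtain ⟨π, hπ1, hπ2, hπ3⟩ := lift_up S hGrad hproj d hd2 hdeg (fun i => B (i - 1)) (- dQ)
    (by
      intro i hi z hz hdz
      rw [LinearMap.neg_apply, neg_eq_zero] at hdz
      obtain ⟨y, hy, e⟩ := hexact _ _ hz (by rw [← hdQ, hdz, map_zero])
      refine ⟨jj.symm (-y), ?_, ?_⟩
      · rw [hB, AddEquiv.apply_symm_apply]
        refine neg_mem ?_
        convert hy using 2
        ring
      · apply jj.injective
        rw [LinearMap.neg_apply, map_neg, hdQ, AddEquiv.apply_symm_apply, map_neg, neg_neg, e])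
    U
    (by
      intro i hi x hx
      rcases eq_or_ne i 0 with rfl | h
      · rw [hB, hU0 x hx]
        exact neg_mem (hdeg 0 x hx)
      · rw [hU1 i h x hx]
        exact zero_mem _)
    (by
      intro i hi x hx
      rw [hU1 i (by omega) x hx, map_zero]
      rcases eq_or_ne i 1 with rfl | h
      · apply jj.injective
        rw [hU0 (d x) (hdeg _ x hx), hd2, map_zero, neg_zero]
      · rw [hU1 (i - 1) (by omega) _ (hdeg _ x hx)])
    0 (fun x hx => by simp)
    (by
      intro x hx
      apply jj.injective
      rw [LinearMap.zero_apply, sub_zero, LinearMap.neg_apply, map_neg, hdQ, hU0 x hx, map_neg, hd2]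
      simp)
  have hπdeg : ∀ i : ℤ, 0 ≤ i → ∀ x ∈ S i, jj (π x) ∈ S i := by
    intro i hi x hx
    have := hπ2 i hi x hx
    rwa [add_sub_cancel_right] at this
  have hπ0 : ∀ x ∈ S 0, d (jj (π x)) = d x := by
    intro x hx
    have h1 := congrArg jj (hπ3 0 le_rfl x hx)
    rw [hπ1 _ (by omega) _ (hdeg 0 x hx), hU0 x hx, LinearMap.zero_apply, add_zero,
      LinearMap.neg_apply, map_neg, hdQ, neg_inj] at h1
    exact h1
  have hπc : ∀ i : ℤ, 1 ≤ i → ∀ x ∈ S i, d (jj (π x)) = jj (π (d x)) := by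
    intro i hi x hx
    have h1 := hπ3 i (by omega) x hx
    rw [hU1 i (by omega) x hx, LinearMap.neg_apply, neg_add_eq_zero] at h1
    rw [← hdQ, h1]
  -- `π` as a `kH`-linear endomorphism of `M`
  let π' : M →ₗ[MonoidAlgebra k H] M :=
    { toFun := fun x => jj (π x)
      map_add' := by intro x y; simp
      map_smul' := by
        intro r x
        rw [RingHom.id_apply, hc, map_smul, hjj]
        congr 1
        rw [← RingHom.comp_apply, ← mapDomainRingHom_comp]
        have : ((MonoidHom.snd C H).comp e.symm.toMonoidHom).comp
            (e.toMonoidHom.comp (MonoidHom.inr C H)) = MonoidHom.id H := by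
          ext h; simp
        rw [this]
        simp }
  have hπ' : ∀ x, π' x = jj (π x) := fun x => rfl
  obtain ⟨σ, hσ1, hσ2, hσ3⟩ := lift_up S' hGrad' hproj' d' hd2 hdeg S' d'
    (fun i _ z hz hdz => hexact i z hz hdz) (π' - LinearMap.id)
    (by
      intro i hi x hx
      exact (S i).sub_mem (hπdeg i hi x hx) hx)
    (by
      intro i hi x hx
      have := hπc i hi x hx
      change d (jj (π x) - x) = jj (π (d x)) - d x
      rw [map_sub, this])
    0 (fun x hx => by simp)
    (by
      intro x hx
      change d ((jj (π x) - x) - 0) = 0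
      rw [sub_zero, map_sub, hπ0 x hx, sub_self])
  have hσdeg : ∀ i : ℤ, 0 ≤ i → ∀ x ∈ S i, σ x ∈ S (i + 1) := hσ2
  have hσc : ∀ i : ℤ, 0 ≤ i → ∀ x ∈ S i, d x = 0 → d (σ x) = jj (π x) - x := by
    intro i hi x hx hdx
    have h1 : d (σ x) + σ (d x) = jj (π x) - x := hσ3 i hi x hx
    rwa [hdx, map_zero, add_zero] at h1
  let u : MonoidAlgebra k G := ∑ h : H, single (e (1, h)) (1 : k)
  let v : MonoidAlgebra k G := ∑ c : C, single (e (c, 1)) (1 : k)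
  let u' : MonoidAlgebra k H := ∑ h : H, single h (1 : k)
  have hu' : ∀ x : M, u' • x = u • x := by
    intro x
    simp only [u, u', Finset.sum_smul, hc1]
  have hju : ∀ q : Q, jj (u • q) = u • jj q := by
    intro q
    rw [← hu']
    simp only [u, u', Finset.sum_smul, map_sum, hj1]
  have hσu : ∀ x, σ (u • x) = u • σ x := by
    intro x
    rw [← hu', map_smul, hu']
  have hvu : v * u = N := by
    rw [hN, ← e.toEquiv.sum_comp, Fintype.sum_prod_type, Finset.sum_mul_sum]
    refine Finset.sum_congr rfl fun c _ => Finset.sum_congr rfl fun h _ => ?_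
    simp only [single_mul_single, ← map_mul, Prod.mk_mul_mk, mul_one, one_mul, MulEquiv.toEquiv_eq_coe,
      MulEquiv.coe_toEquiv]
  have huu : u * u = 0 := by
    have h1 : ∀ h : H, single (e (1, h)) (1 : k) * u = u := by
      intro h
      simp only [u, Finset.mul_sum, single_mul_single, ← map_mul, Prod.mk_mul_mk, mul_one]
      exact Fintype.sum_bijective (h * ·) (Group.mulLeft_bijective h) _ _ fun _ => rfl
    have h2 : u * u = ∑ h : H, single (e (1, h)) (1 : k) * u := by
      rw [← Finset.sum_mul]
    rw [h2, Finset.sum_congr rfl (fun h _ => h1 h), Finset.sum_const, Finset.card_univ,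
      ← Nat.cast_smul_eq_nsmul k, hH, zero_smul]
  have hjv : ∀ q : Q, jj (v • q) = 0 := by
    intro q
    simp only [v, Finset.sum_smul, map_sum, hj1]
    rw [Finset.sum_const, Finset.card_univ, ← Nat.cast_smul_eq_nsmul k, hC, zero_smul]
  rw [← hvu] at hdm hf0 ⊢
  refine key_vanish S hGrad hproj d hd2 hdeg hexact B dQ π u v huu ?_ ?_ a ha f hf hfdeg hf0 j hj m hm hdm
  · intro i hi z hz q hq hdz hπz
    have hπz' : jj (π (u • z)) = d (u • jj q) := by
      rw [hπz, hdQ, hju]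
    have hq' : jj q ∈ S (i + 1) := hq
    -- `y = q - σ z`
    set y : M := jj q - σ z with hy
    have hyS : y ∈ S (i + 1) := sub_mem hq' (hσdeg i hi z hz)
    have hdy : d (u • y) = u • z := by
      have h1 := hσc i hi (u • z) ((S i).smul_mem u hz) hdz
      rw [hσu] at h1
      rw [hy, smul_sub, map_sub, h1, hπz']
      abel
    set w : M := jj (π y) - jj q with hw
    have hwS : w ∈ S (i + 1) := sub_mem (hπdeg _ (by omega) y hyS) hq'
    have huw : u • w = jj (π (u • y)) - u • jj q := by
      rw [hw, smul_sub, map_smul, hju]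
    have hdw : d (u • w) = 0 := by
      rw [huw, map_sub, hπc (i + 1) (by omega) _ ((S _).smul_mem u hyS), hdy, hπz', sub_self]
    refine ⟨y - w, sub_mem hyS hwS, jj.symm (- σ w), ?_, ?_, ?_⟩
    · rw [hB, AddEquiv.apply_symm_apply]
      refine neg_mem ?_
      convert hσdeg _ (by omega) w hwS using 2
      ring
    · rw [smul_sub, map_sub, hdw, hdy, sub_zero]
    · apply jj.injective
      have h1 := hσc _ (by omega) (u • w) ((S _).smul_mem u hwS) hdw
      rw [hσu] at h1
      rw [map_sub, hdQ, hju, hju, AddEquiv.apply_symm_apply, smul_neg, map_neg, h1, smul_sub, map_sub,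
        map_sub, sub_neg_eq_add]
      have h2 : jj (π (u • y)) = u • w + u • jj q := by rw [huw]; abel
      rw [h2]
      abel
  · intro i hi x hx
    apply jj.injective
    rw [mul_smul, map_smul, hjv, map_zero]

/-- A type synonym carrying the inflated module structure. -/
def Infl (M : Type) : Type := M

instance inflAddCommGroup (M : Type) [h : AddCommGroup M] : AddCommGroup (Infl M) := h

/-- The identity as an additive equivalence. -/
def inflEquiv (M : Type) [AddCommGroup M] : Infl M ≃+ M := AddEquiv.refl M

/-- The module structure on the synonym obtained by restriction along a ring map. -/
abbrev inflModule (M : Type) {R R' : Type} [AddCommGroup M] [Ring R] [Ring R'] [h : Module R' M]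
    (φ : R →+* R') : Module R (Infl M) :=
  Module.compHom M φ

/-- Splitting off the first coordinate of an elementary abelian group. -/
def splitFirst (p n : ℕ) : Multiplicative (ZMod p) × Multiplicative (Fin n → ZMod p) ≃*
    Multiplicative (Fin (n + 1) → ZMod p) where
  toFun x := Multiplicative.ofAdd (Fin.cons x.1.toAdd x.2.toAdd)
  invFun y := (Multiplicative.ofAdd (y.toAdd 0), Multiplicative.ofAdd (Fin.tail y.toAdd))
  left_inv x := by simp
  right_inv y := by simp
  map_mul' x y := by
    apply Multiplicative.toAdd.injective
    funext i
    refine Fin.cases ?_ (fun i => ?_) i <;> simp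

/-- The vanishing theorem for a product of two groups of order divisible by the characteristic. -/
theorem main_abstract {k C H G : Type} [Field k] [CommGroup C] [CommGroup H] [CommGroup G]
    [Fintype C] [Fintype H] [Fintype G] (e : C × H ≃* G)
    (hC : (Fintype.card C : k) = 0) (hH : (Fintype.card H : k) = 0)
    -- the trivial module `k` over `kE`
    (T : Type) [AddCommGroup T] [Module k T]
    [Module (MonoidAlgebra k G) T]
    [IsScalarTower k (MonoidAlgebra k G) T]
    (e0 : T ≃ₗ[k] k)
    (htriv : ∀ (g : G) (t : T),
      (MonoidAlgebra.single g (1 : k) :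
        MonoidAlgebra k G) • t = t)
    -- a complete resolution of `T`
    (Mbig : Type) [AddCommGroup Mbig]
    [Module (MonoidAlgebra k G) Mbig]
    (S : ℤ → Submodule (MonoidAlgebra k G) Mbig)
    (hinternal : DirectSum.IsInternal S)
    (hproj : ∀ i, Module.Projective
      (MonoidAlgebra k G) (S i))
    (d : Mbig →ₗ[MonoidAlgebra k G] Mbig)
    (hd2 : d ∘ₗ d = 0)
    (hdeg : ∀ (i : ℤ), ∀ x ∈ S i, d x ∈ S (i - 1))
    (hexact : ∀ (i : ℤ), ∀ x ∈ S i, d x = 0 → ∃ y ∈ S (i + 1), d y = x)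
    (ε : Mbig →ₗ[MonoidAlgebra k G] T)
    (hεd : ε ∘ₗ d = 0)
    (hεout : ∀ (i : ℤ), i ≠ 0 → ∀ x ∈ S i, ε x = 0)
    (hεsurj : ∀ t : T, ∃ x ∈ S 0, ε x = t)
    (hεker : ∀ x ∈ S 0, ε x = 0 → ∃ y ∈ S 1, d y = x)
    -- two chain maps of negative Tate degrees `-a` and `-b`
    (a b : ℤ) (ha : 0 < a) (hb : 0 < b)
    (f g : Mbig →ₗ[MonoidAlgebra k G] Mbig)
    (hfcomm : f ∘ₗ d = d ∘ₗ f) (hgcomm : g ∘ₗ d = d ∘ₗ g)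
    (hfdeg : ∀ (i : ℤ), ∀ x ∈ S i, f x ∈ S (i + a))
    (hgdeg : ∀ (i : ℤ), ∀ x ∈ S i, g x ∈ S (i + b)) :
    -- the product `f · g` is zero in Tate cohomology: `f ∘ g` is null-homotopic
    ∃ s : Mbig →ₗ[MonoidAlgebra k G] Mbig,
      (∀ (i : ℤ), ∀ x ∈ S i, s x ∈ S (i + a + b + 1)) ∧
      f ∘ₗ g = d ∘ₗ s + s ∘ₗ d := by
  have hd2' : ∀ x, d (d x) = 0 := fun x => LinearMap.congr_fun hd2 x
  have hεd' : ∀ x, ε (d x) = 0 := fun x => LinearMap.congr_fun hεd x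
  have hf : ∀ x, f (d x) = d (f x) := fun x => LinearMap.congr_fun hfcomm x
  have hg : ∀ x, g (d x) = d (g x) := fun x => LinearMap.congr_fun hgcomm x
  let iR : (MonoidAlgebra k H) →+* (MonoidAlgebra k G) := mapDomainRingHom k (e.toMonoidHom.comp (MonoidHom.inr C H))
  let pR : (MonoidAlgebra k G) →+* (MonoidAlgebra k H) := mapDomainRingHom k ((MonoidHom.snd C H).comp e.symm.toMonoidHom)
  let _ : Module k Mbig := Module.compHom Mbig (algebraMap k (MonoidAlgebra k G))
  have t1 : IsScalarTower k (MonoidAlgebra k G) Mbig := IsScalarTower.of_algebraMap_smul fun _ _ => rfl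
  let _ : Module (MonoidAlgebra k H) Mbig := Module.compHom Mbig iR
  have t2 : IsScalarTower k (MonoidAlgebra k H) Mbig := IsScalarTower.of_algebraMap_smul fun c x => by
    change (iR (algebraMap k (MonoidAlgebra k H) c)) • x = (algebraMap k (MonoidAlgebra k G) c) • x
    congr 1
    simp [iR, map_one e, ← Prod.one_eq_mk]
  let _ : Module (MonoidAlgebra k G) (Infl Mbig) := inflModule Mbig pR
  let jj : Infl Mbig ≃+ Mbig := inflEquiv Mbig
  -- the invariant generator
  obtain ⟨x0, hx0, hεx0⟩ := hεsurj (e0.symm 1)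
  have hdx : ∀ x ∈ S 0, d x = e0 (ε x) • d x0 := by
    intro x hx
    have hmem : (algebraMap k (MonoidAlgebra k G) (e0 (ε x))) • x0 ∈ S 0 := (S 0).smul_mem _ hx0
    have h1 : ε (x - (algebraMap k (MonoidAlgebra k G) (e0 (ε x))) • x0) = 0 := by
      rw [map_sub, map_smul, hεx0, algebraMap_smul, ← map_smul e0.symm, smul_eq_mul, mul_one,
        LinearEquiv.symm_apply_apply, sub_self]
    obtain ⟨y, hy, hxy⟩ := hεker _ ((S 0).sub_mem hx hmem) h1
    have h2 := hd2' y
    rw [hxy, map_sub, map_smul, sub_eq_zero, algebraMap_smul] at h2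
    exact h2
  have hinv : ∀ (g : G), ∀ x ∈ S 0, d ((single g (1 : k) : (MonoidAlgebra k G)) • x) = d x := by
    intro g x hx
    rw [hdx _ ((S 0).smul_mem _ hx), map_smul, htriv, ← hdx x hx]
  -- Higman maps
  have hθ : ∀ i, ∃ θ : S i →ₗ[k] S i, ∀ x, ∑ g : G, (single g⁻¹ (1 : k) : (MonoidAlgebra k G)) •
      θ ((single g (1 : k) : (MonoidAlgebra k G)) • x) = x := by
    intro i
    have := hproj i
    exact higman_exists (k := k) (G := G) (P := S i)
  have hinj : ∀ i, Module.Injective (MonoidAlgebra k G) (S i) := by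
    intro i
    obtain ⟨θ, h⟩ := hθ i
    exact higman_injective θ h
  obtain ⟨N, hN⟩ : ∃ N : (MonoidAlgebra k G), N = ∑ g : G, single g (1 : k) := ⟨_, rfl⟩
  have hinvN : ∀ i, ∀ x ∈ S i, (∀ g : G, (single g (1 : k) : (MonoidAlgebra k G)) • x = x) → ∃ m ∈ S i, x = N • m := by
    intro i x hx hgx
    obtain ⟨θ, h⟩ := hθ i
    refine ⟨θ ⟨x, hx⟩, (θ ⟨x, hx⟩).2, ?_⟩
    have h1 := h ⟨x, hx⟩
    have h2 : ∀ g : G, (single g (1 : k) : (MonoidAlgebra k G)) • (⟨x, hx⟩ : S i) = ⟨x, hx⟩ :=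
      fun g => Subtype.ext (hgx g)
    simp only [h2] at h1
    rw [← Finset.sum_smul] at h1
    have h3 : ∑ g : G, (single g⁻¹ (1 : k) : (MonoidAlgebra k G)) = N := by
      rw [hN]
      exact Fintype.sum_bijective (·⁻¹) inv_involutive.bijective _ _ fun _ => rfl
    rw [h3] at h1
    exact (congrArg Subtype.val h1).symm
  have hNinv : ∀ (g : G) (x : Mbig), (single g (1 : k) : (MonoidAlgebra k G)) • N • x = N • x := by
    intro g x
    rw [smul_smul]
    congr 1
    rw [hN, Finset.mul_sum]
    simp only [single_mul_single, mul_one]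
    exact Fintype.sum_bijective (g * ·) (Group.mulLeft_bijective g) _ _ fun _ => rfl
  have hf0 : ∀ (c : ℤ) (φ : Mbig →ₗ[(MonoidAlgebra k G)] Mbig), (∀ i : ℤ, ∀ x ∈ S i, φ x ∈ S (i + c)) →
      ∀ x ∈ S 0, ∃ m ∈ S (c - 1), φ (d x) = N • m := by
    intro c φ hφ x hx
    refine hinvN (c - 1) _ ?_ ?_
    · have := hφ _ _ (hdeg 0 x hx)
      convert this using 2
      ring
    · intro g
      rw [← map_smul, ← map_smul, hinv g x hx]
  obtain ⟨m, hm, hgm⟩ := hf0 b g hgdeg x0 hx0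
  obtain ⟨w, hw, hfw⟩ := group_vanish (k := k) (C := C) (H := H) (G := G) (M := Mbig)
    (Q := Infl Mbig) e hC hH (fun _ _ => rfl) jj (fun _ _ => rfl) S hinternal hproj d hd2' hdeg
    hexact hinv N hN a ha f hf hfdeg (hf0 a f hfdeg) (b - 1) (by omega) m hm
    (by rw [← hgm, ← hg, hd2', map_zero])
  let ω0 : T →ₗ[k] Mbig := (LinearMap.toSpanSingleton k Mbig (N • w)) ∘ₗ e0.toLinearMap
  have hω0 : ∀ t, ω0 t = e0 t • (N • w) := fun t => rfl
  let ω : T →ₗ[(MonoidAlgebra k G)] Mbig := equivariantOfLinearOfComm ω0 (by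
    intro g t
    rw [htriv, hω0, ← algebraMap_smul (MonoidAlgebra k G) (e0 t) (N • w), smul_comm, hNinv])
  have hω : ∀ t, ω t = e0 t • (N • w) := fun t => rfl
  have hkd : ∀ (φ : Mbig →ₗ[(MonoidAlgebra k G)] Mbig) (c : k) (x : Mbig), φ (c • x) = c • φ x := by
    intro φ c x
    exact φ.map_smul (algebraMap k (MonoidAlgebra k G) c) x
  obtain ⟨s, hs1, hs2⟩ := down_up S hinternal hproj hinj d hd2' hdeg hexact (a + b) (f ∘ₗ g)
    (by intro x; simp only [LinearMap.comp_apply, hg, hf])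
    (by
      intro i x hx
      have := hfdeg _ _ (hgdeg i x hx)
      rw [LinearMap.comp_apply]
      convert this using 2
      ring)
    (ω ∘ₗ ε)
    (by
      intro x hx
      rw [LinearMap.comp_apply, hω, ← algebraMap_smul (MonoidAlgebra k G)]
      refine Submodule.smul_mem _ _ (Submodule.smul_mem _ _ ?_)
      convert hw using 2
      ring)
    (by
      intro x hx hdx0
      obtain ⟨y, hy, rfl⟩ := hexact 0 x hx hdx0
      rw [LinearMap.comp_apply, hεd', map_zero])
    (by
      intro x hx
      rw [LinearMap.comp_apply, LinearMap.comp_apply, hω, hdx x hx, hkd, hkd, hkd, hgm, hfw])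
  refine ⟨s, ?_, ?_⟩
  · intro i x hx
    have := hs1 i x hx
    convert this using 2
    ring
  · ext x
    exact hs2 x

/-- Benson–Carlson: Let `k` be a field of characteristic `p` and
`E` an elementary abelian `p`-group of rank `r ≥ 2`.  Then the product of any two
elements of negative degree in the Tate cohomology ring `Ĥ*(E, k)` is zero.

Tate cohomology is modelled by a complete resolution of the trivial module `k`:
a ℤ-graded exact complex `(Mbig, S, d)` of projective `kE`-modules with an
augmentation `ε : Mbig → k` making `S_{≥0} → k` a projective resolution.  An
element of `Ĥ^{-a}(E, k)` (`a > 0`) is (the homotopy class of) a chain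
endomorphism `f` raising the grading by `a`, the cup product is composition of
chain maps, and the class is zero iff the chain map is null-homotopic.  The
statement: the composite of two chain maps of negative Tate degree is
null-homotopic. -/
theorem negative_tate_cohomology_products_vanish
    (k : Type) [Field k] (p : ℕ) (hp : p.Prime) [CharP k p]
    (r : ℕ) (hr : 2 ≤ r)
    -- the trivial module `k` over `kE`
    (T : Type) [AddCommGroup T] [Module k T]
    [Module (MonoidAlgebra k (Multiplicative (Fin r → ZMod p))) T]
    [IsScalarTower k (MonoidAlgebra k (Multiplicative (Fin r → ZMod p))) T]
    (e0 : T ≃ₗ[k] k)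
    (htriv : ∀ (g : Multiplicative (Fin r → ZMod p)) (t : T),
      (MonoidAlgebra.single g (1 : k) :
        MonoidAlgebra k (Multiplicative (Fin r → ZMod p))) • t = t)
    -- a complete resolution of `T`
    (Mbig : Type) [AddCommGroup Mbig]
    [Module (MonoidAlgebra k (Multiplicative (Fin r → ZMod p))) Mbig]
    (S : ℤ → Submodule (MonoidAlgebra k (Multiplicative (Fin r → ZMod p))) Mbig)
    (hinternal : DirectSum.IsInternal S)
    (hproj : ∀ i, Module.Projective
      (MonoidAlgebra k (Multiplicative (Fin r → ZMod p))) (S i))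
    (d : Mbig →ₗ[MonoidAlgebra k (Multiplicative (Fin r → ZMod p))] Mbig)
    (hd2 : d ∘ₗ d = 0)
    (hdeg : ∀ (i : ℤ), ∀ x ∈ S i, d x ∈ S (i - 1))
    (hexact : ∀ (i : ℤ), ∀ x ∈ S i, d x = 0 → ∃ y ∈ S (i + 1), d y = x)
    (ε : Mbig →ₗ[MonoidAlgebra k (Multiplicative (Fin r → ZMod p))] T)
    (hεd : ε ∘ₗ d = 0)
    (hεout : ∀ (i : ℤ), i ≠ 0 → ∀ x ∈ S i, ε x = 0)
    (hεsurj : ∀ t : T, ∃ x ∈ S 0, ε x = t)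
    (hεker : ∀ x ∈ S 0, ε x = 0 → ∃ y ∈ S 1, d y = x)
    -- two chain maps of negative Tate degrees `-a` and `-b`
    (a b : ℤ) (ha : 0 < a) (hb : 0 < b)
    (f g : Mbig →ₗ[MonoidAlgebra k (Multiplicative (Fin r → ZMod p))] Mbig)
    (hfcomm : f ∘ₗ d = d ∘ₗ f) (hgcomm : g ∘ₗ d = d ∘ₗ g)
    (hfdeg : ∀ (i : ℤ), ∀ x ∈ S i, f x ∈ S (i + a))
    (hgdeg : ∀ (i : ℤ), ∀ x ∈ S i, g x ∈ S (i + b)) :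
    -- the product `f · g` is zero in Tate cohomology: `f ∘ g` is null-homotopic
    ∃ s : Mbig →ₗ[MonoidAlgebra k (Multiplicative (Fin r → ZMod p))] Mbig,
      (∀ (i : ℤ), ∀ x ∈ S i, s x ∈ S (i + a + b + 1)) ∧
      f ∘ₗ g = d ∘ₗ s + s ∘ₗ d := by
  obtain ⟨n, rfl⟩ : ∃ n, r = n + 1 := ⟨r - 1, by omega⟩
  have hfact : Fact p.Prime := ⟨hp⟩
  have hn : n ≠ 0 := by omega
  refine main_abstract (splitFirst p n) ?_ ?_ T e0 htriv Mbig S hinternal hproj d hd2 hdeg hexact ε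
    hεd hεout hεsurj hεker a b ha hb f g hfcomm hgcomm hfdeg hgdeg
  · simp [ZMod.card]
  · simp [ZMod.card, hn]
end

section
/- Let k be a field of characteristic p and E an elementary abelian p-group of order at least p². Then the ring R = Ĥ^{≤0}(E, k) (the non-positive part of the Tate cohomology ring) is a local k-algebra whose maximal ideal m = Ĥ^{<0}(E, k) satisfies m² = 0, and m is not finitely generated as an ideal. -/
open MonoidAlgebra

section Part1

theorem tt_glue {A M : Type} [Ring A] [AddCommGroup M] [Module A M] {S : ℤ → Submodule A M}
    (hS : DirectSum.IsInternal S) (s : ℤ → (M →ₗ[A] M)) :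
    ∃ t : M →ₗ[A] M, ∀ i, ∀ x ∈ S i, t x = s i x := by
  classical
  let eq := LinearEquiv.ofBijective (DirectSum.coeLinearMap S) hS
  refine ⟨(DirectSum.toModule A ℤ M (fun i => (s i) ∘ₗ (S i).subtype)) ∘ₗ eq.symm.toLinearMap, ?_⟩
  intro i x hx
  have h1 : eq.symm x = DirectSum.lof A ℤ (fun i => S i) i ⟨x, hx⟩ := by
    rw [LinearEquiv.symm_apply_eq]
    exact (DirectSum.coeLinearMap_lof S i ⟨x, hx⟩).symm
  simp [h1]

theorem tt_ext {A M N : Type} [Ring A] [AddCommGroup M] [Module A M] [AddCommGroup N] [Module A N]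
    {S : ℤ → Submodule A M}
    (hS : DirectSum.IsInternal S) (f g : M →ₗ[A] N) (h : ∀ i, ∀ x ∈ S i, f x = g x) : f = g := by
  classical
  have : LinearMap.eqLocus f g = ⊤ := by
    rw [eq_top_iff, ← hS.submodule_iSup_eq_top]
    exact iSup_le fun i x hx => h i x hx
  ext x
  have hx : x ∈ LinearMap.eqLocus f g := by rw [this]; trivial
  exact hx

theorem tt_pr {A M : Type} [Ring A] [AddCommGroup M] [Module A M] {S : ℤ → Submodule A M}
    (hS : DirectSum.IsInternal S) :
    ∃ pr : ℤ → (M →ₗ[A] M), (∀ i x, pr i x ∈ S i) ∧ (∀ i, ∀ x ∈ S i, pr i x = x) ∧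
      (∀ i j, i ≠ j → ∀ x ∈ S i, pr j x = 0) := by
  classical
  let eq := LinearEquiv.ofBijective (DirectSum.coeLinearMap S) hS
  refine ⟨fun j => (S j).subtype ∘ₗ (DirectSum.component A ℤ (fun i => S i) j) ∘ₗ
    eq.symm.toLinearMap, ?_, ?_, ?_⟩
  · intro i x
    simp
  · intro i x hx
    have h1 : eq.symm x = DirectSum.lof A ℤ (fun i => S i) i ⟨x, hx⟩ := by
      rw [LinearEquiv.symm_apply_eq]
      exact (DirectSum.coeLinearMap_lof S i ⟨x, hx⟩).symm
    simp [h1]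
  · intro i j hij x hx
    have h1 : eq.symm x = DirectSum.lof A ℤ (fun i => S i) i ⟨x, hx⟩ := by
      rw [LinearEquiv.symm_apply_eq]
      exact (DirectSum.coeLinearMap_lof S i ⟨x, hx⟩).symm
    simp [h1, DirectSum.component.of, hij]

theorem tt_mem {A M : Type} [Ring A] [AddCommGroup M] [Module A M] {S : ℤ → Submodule A M}
    {i j : ℤ} {x : M} (h : x ∈ S i) (hij : i = j) : x ∈ S j := hij ▸ h

theorem tt_chain {α : Type} (C : ℤ → α → Prop) (L : ℤ → α → α → Prop) (i0 : ℤ) (a0 : α)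
    (h0 : C i0 a0)
    (up : ∀ i a, C i a → ∃ b, C (i + 1) b ∧ L i a b)
    (down : ∀ i b, C (i + 1) b → ∃ a, C i a ∧ L i a b) :
    ∃ s : ℤ → α, s i0 = a0 ∧ (∀ i, C i (s i)) ∧ ∀ i, L i (s i) (s (i + 1)) := by
  classical
  choose! U hU1 hU2 using up
  choose! V hV1 hV2 using down
  let u : ℕ → α := fun n => Nat.rec a0 (fun m a => U (i0 + m) a) n
  let v : ℕ → α := fun n => Nat.rec a0 (fun m a => V (i0 - m - 1) a) n
  have hu : ∀ n : ℕ, C (i0 + n) (u n) := by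
    intro n
    induction n with
    | zero => simpa [u, v] using h0
    | succ n ih =>
      have := hU1 _ _ ih
      push_cast
      rw [← add_assoc]
      exact this
  have hv : ∀ n : ℕ, C (i0 - n) (v n) := by
    intro n
    induction n with
    | zero => simpa [u, v] using h0
    | succ n ih =>
      have := hV1 (i0 - n - 1) (v n) (by simpa using ih)
      push_cast
      rw [← sub_sub]
      exact this
  let s : ℤ → α := fun i => if i0 ≤ i then u (i - i0).toNat else v (i0 - i).toNat
  have su : ∀ n : ℕ, s (i0 + n) = u n := by
    intro n
    simp [s]
  have sv : ∀ n : ℕ, s (i0 - n) = v n := by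
    intro n
    rcases Nat.eq_zero_or_pos n with h | h
    · subst h
      simp [s, u, v]
    · have : ¬ i0 ≤ i0 - n := by omega
      simp only [s, if_neg this]
      congr 1
      omega
  have cases : ∀ i : ℤ, (∃ n : ℕ, i = i0 + n) ∨ (∃ n : ℕ, i = i0 - n - 1) := by
    intro i
    rcases le_or_gt i0 i with h | h
    · exact Or.inl ⟨(i - i0).toNat, by omega⟩
    · exact Or.inr ⟨(i0 - i - 1).toNat, by omega⟩
  refine ⟨s, ?_, ?_, ?_⟩
  · simpa [u] using su 0
  · intro i
    rcases cases i with ⟨n, rfl⟩ | ⟨n, rfl⟩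
    · rw [su]; exact hu n
    · have h1 := sv (n + 1)
      have h2 := hv (n + 1)
      push_cast at h1 h2
      rw [← sub_sub] at h1 h2
      rw [h1]; exact h2
  · intro i
    rcases cases i with ⟨n, rfl⟩ | ⟨n, rfl⟩
    · have h1 := su (n + 1)
      push_cast at h1
      rw [← add_assoc] at h1
      rw [su, h1]
      exact hU2 _ _ (hu n)
    · have h1 := sv (n + 1)
      push_cast at h1
      rw [← sub_sub] at h1
      rw [h1, sub_add_cancel, sv]
      exact hV2 _ _ (by simpa using hv n)

/-- graded `k`-linear contraction of an exact complex -/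
theorem tt_contraction {k M : Type} [Field k] [AddCommGroup M] [Module k M]
    {S : ℤ → Submodule k M} (hS : DirectSum.IsInternal S) (d : M →ₗ[k] M)
    (hd2 : ∀ x, d (d x) = 0)
    (hdeg : ∀ (i : ℤ), ∀ x ∈ S i, d x ∈ S (i - 1))
    (hexact : ∀ (i : ℤ), ∀ x ∈ S i, d x = 0 → ∃ y ∈ S (i + 1), d y = x) :
    ∃ σ : M →ₗ[k] M, (∀ i, ∀ x ∈ S i, σ x ∈ S (i + 1)) ∧ ∀ x, d (σ x) + σ (d x) = x := by
  classical
  have h1 : ∀ i : ℤ, ∃ τ : M →ₗ[k] M, (∀ x, τ x ∈ S (i + 1)) ∧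
      ∀ x ∈ S i, d x = 0 → d (τ x) = x := by
    intro i
    let K : Submodule k M := S i ⊓ LinearMap.ker d
    let dd : S (i + 1) →ₗ[k] K := LinearMap.codRestrict K (d ∘ₗ (S (i + 1)).subtype) (by
      intro x
      refine ⟨?_, ?_⟩
      · exact tt_mem (hdeg _ _ x.2) (by ring)
      · simp [hd2])
    have hsurj : LinearMap.range dd = ⊤ := by
      rw [LinearMap.range_eq_top]
      rintro ⟨x, hx1, hx2⟩
      obtain ⟨y, hy, hyx⟩ := hexact i x hx1 (by simpa using hx2)
      exact ⟨⟨y, hy⟩, Subtype.ext hyx⟩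
    obtain ⟨g, hg⟩ := LinearMap.exists_rightInverse_of_surjective dd hsurj
    obtain ⟨G, hG⟩ := LinearMap.exists_extend g
    refine ⟨(S (i + 1)).subtype ∘ₗ G, fun x => by simp, ?_⟩
    intro x hx hdx
    have e1 : G x = g ⟨x, hx, by simpa using hdx⟩ := by rw [← hG]; rfl
    have e2 := LinearMap.congr_fun hg ⟨x, hx, by simpa using hdx⟩
    have e3 := congrArg Subtype.val e2
    simp only [LinearMap.comp_apply, e1]
    exact e3
  choose τ' hτ1 hτ2 using h1
  obtain ⟨τ, hτ⟩ := tt_glue hS τ'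
  have key : ∀ i, ∀ x ∈ S i, d x = 0 → d (τ x) = x := fun i x hx hdx => by
    rw [hτ i x hx]; exact hτ2 i x hx hdx
  have kdeg : ∀ i, ∀ x ∈ S i, τ x ∈ S (i + 1) := fun i x hx => by
    rw [hτ i x hx]; exact hτ1 i x
  refine ⟨τ ∘ₗ (LinearMap.id - τ ∘ₗ d), ?_, ?_⟩
  · intro i x hx
    refine kdeg i _ ?_
    refine Submodule.sub_mem _ hx ?_
    exact tt_mem (kdeg _ _ (hdeg i x hx)) (by ring)
  · have : d ∘ₗ (τ ∘ₗ (LinearMap.id - τ ∘ₗ d)) + (τ ∘ₗ (LinearMap.id - τ ∘ₗ d)) ∘ₗ d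
        = LinearMap.id := by
      refine tt_ext hS _ _ ?_
      intro i x hx
      have a1 : x - τ (d x) ∈ S i := Submodule.sub_mem _ hx (tt_mem (kdeg _ _ (hdeg i x hx)) (by ring))
      have a2 : d (x - τ (d x)) = 0 := by
        rw [map_sub, key _ _ (hdeg i x hx) (hd2 x), sub_self]
      have a3 := key i _ a1 a2
      simp only [LinearMap.add_apply, LinearMap.comp_apply, LinearMap.sub_apply, LinearMap.id_apply]
      rw [a3, hd2]
      simp
    intro x
    exact LinearMap.congr_fun this x

theorem tt_L1 {k M H : Type} [Field k] [AddCommGroup M] [Module k M] [Group H] [Fintype H]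
    (ρ : H →* Module.End k M)
    {S : ℤ → Submodule k M} (hS : DirectSum.IsInternal S)
    (hρS : ∀ h i, ∀ x ∈ S i, ρ h x ∈ S i)
    (d : M →ₗ[k] M)
    (hd2 : ∀ x, d (d x) = 0)
    (hdeg : ∀ (i : ℤ), ∀ x ∈ S i, d x ∈ S (i - 1))
    (hdρ : ∀ h x, d (ρ h x) = ρ h (d x))
    (σ : M →ₗ[k] M) (hσ : ∀ i, ∀ x ∈ S i, σ x ∈ S (i + 1))
    (hσd : ∀ x, d (σ x) + σ (d x) = x)
    (π : M →ₗ[k] M) (hπ : ∀ i, ∀ x ∈ S i, π x ∈ S i)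
    (htr : ∀ x, ∑ h : H, ρ h (π (ρ h⁻¹ x)) = x)
    (e : M) (he : e ∈ S (-1)) (hne : e ≠ 0) (hspan : ∀ x ∈ S (-1), d x = 0 → ∃ c : k, x = c • e)
    (hρe : ∀ h, ρ h e = e) (hde : d e = 0)
    (c ε : ℤ) (hε : ε * ε = 1) (φ : M →ₗ[k] M) (hφ : ∀ i, ∀ x ∈ S i, φ x ∈ S (i + c))
    (hφρ : ∀ h x, φ (ρ h x) = ρ h (φ x))
    (hφd : ∀ x, d (φ x) = ε • φ (d x))
    (z : M) (hz : z ∈ S c) (hρz : ∀ h, ρ h z = z) (hdz : d z = φ e) :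
    ∃ s : M →ₗ[k] M, (∀ h x, s (ρ h x) = ρ h (s x)) ∧
      (∀ i, ∀ x ∈ S i, s x ∈ S (i + c + 1)) ∧ (∀ x, d (s x) + ε • s (d x) = φ x) ∧ s e = z := by
  classical
  -- averaging
  let Av : (M →ₗ[k] M) → (M →ₗ[k] M) := fun T => ∑ h : H, (ρ h) ∘ₗ T ∘ₗ (ρ h⁻¹)
  have hAv : ∀ T x, Av T x = ∑ h : H, ρ h (T (ρ h⁻¹ x)) := by
    intro T x; simp [Av, LinearMap.sum_apply]
  have hAvρ : ∀ T g x, Av T (ρ g x) = ρ g (Av T x) := by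
    intro T g x
    rw [hAv, hAv, map_sum]
    refine (Fintype.sum_equiv (Equiv.mulLeft g) _ _ ?_).symm
    intro h
    simp only [Equiv.coe_mulLeft, map_mul, mul_inv_rev, Module.End.mul_apply]
    congr 3
    rw [← Module.End.mul_apply (ρ g⁻¹), ← map_mul]
    simp
  have hAvdeg : ∀ (T : M →ₗ[k] M) i j, (∀ x ∈ S i, T x ∈ S j) → ∀ x ∈ S i, Av T x ∈ S j := by
    intro T i j hT x hx
    rw [hAv]
    exact Submodule.sum_mem _ fun h _ => hρS _ _ _ (hT _ (hρS _ _ _ hx))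
  obtain ⟨lam, hlam⟩ : ∃ lam : M →ₗ[k] k, lam e = 1 := 
    Module.Projective.exists_dual_eq_one k hne
  let C : ℤ → (M →ₗ[k] M) → Prop := fun i s => (∀ h x, s (ρ h x) = ρ h (s x)) ∧
    (∀ x ∈ S i, s x ∈ S (i + c + 1)) ∧ (∀ x ∈ S i, d x = 0 → d (s x) = φ x)
  let L : ℤ → (M →ₗ[k] M) → (M →ₗ[k] M) → Prop := fun i s s' =>
    ∀ x ∈ S (i + 1), d (s' x) + ε • s (d x) = φ x
  let s0 : M →ₗ[k] M := Av ((LinearMap.toSpanSingleton k M (π z)) ∘ₗ lam)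
  have hs0e : s0 e = z := by
    simp only [s0, hAv, LinearMap.comp_apply, hρe, hlam]
    conv_rhs => rw [← htr z]
    simp [hρz]
  have h0 : C (-1) s0 := by
    refine ⟨fun h x => hAvρ _ _ _, ?_, ?_⟩
    · refine hAvdeg _ _ _ ?_
      intro x _
      simp only [LinearMap.comp_apply, LinearMap.toSpanSingleton_apply]
      exact Submodule.smul_mem _ _ (tt_mem (hπ _ _ hz) (by ring))
    · intro x hx hdx
      obtain ⟨a, rfl⟩ := hspan x hx hdx
      simp [hs0e, hdz]
  obtain ⟨s, hs_start, hsC, hsL⟩ := tt_chain C L (-1) s0 h0 (by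
    rintro i s ⟨h1, h2, h3⟩
    let g : M →ₗ[k] M := φ - ε • (s ∘ₗ d)
    have hg : ∀ x, g x = φ x - ε • s (d x) := fun x => by simp [g]
    have hgρ : ∀ h x, g (ρ h x) = ρ h (g x) := by
      intro h x
      rw [hg, hg, hφρ, hdρ, h1, map_sub, map_zsmul]
    have hgd : ∀ x ∈ S (i + 1), d (g x) = 0 := by
      intro x hx
      rw [hg, map_sub, map_zsmul, hφd, h3 _ (tt_mem (hdeg _ _ hx) (by ring)) (hd2 x), sub_self]
    have hgdeg : ∀ x ∈ S (i + 1), g x ∈ S (i + 1 + c) := by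
      intro x hx
      rw [hg]
      refine Submodule.sub_mem _ (hφ _ _ hx) (zsmul_mem ?_ _)
      exact tt_mem (h2 _ (tt_mem (hdeg _ _ hx) (by ring : i + 1 - 1 = i))) (by ring)
    let s' := Av (σ ∘ₗ g ∘ₗ π)
    have hs' : ∀ x ∈ S (i + 1), d (s' x) = g x := by
      intro x hx
      simp only [s', hAv, map_sum, hdρ, LinearMap.comp_apply]
      have : ∀ h : H, d (σ (g (π (ρ h⁻¹ x)))) = g (π (ρ h⁻¹ x)) := by
        intro h
        have h5 := hσd (g (π (ρ h⁻¹ x)))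
        rwa [hgd _ (hπ _ _ (hρS _ _ _ hx)), map_zero, add_zero] at h5
      simp only [this, ← hgρ]
      rw [← map_sum, htr]
    refine ⟨s', ⟨fun h x => hAvρ _ _ _, ?_, ?_⟩, ?_⟩
    · refine hAvdeg _ _ _ ?_
      intro x hx
      exact hσ _ _ (hgdeg _ (hπ _ _ hx))
    · intro x hx hdx
      rw [hs' x hx, hg, hdx]; simp
    · intro x hx
      rw [hs' x hx, hg]; simp) (by
    rintro i s ⟨h1, h2, h3⟩
    let g : M →ₗ[k] M := ε • (φ - d ∘ₗ s)
    have hg : ∀ x, g x = ε • (φ x - d (s x)) := fun x => by simp [g]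
    have hgρ : ∀ h x, g (ρ h x) = ρ h (g x) := by
      intro h x
      rw [hg, hg, hφρ, h1, hdρ, map_zsmul, map_sub]
    have hgd : ∀ x ∈ S (i + 1), d x = 0 → g x = 0 := by
      intro x hx hdx
      rw [hg, h3 x hx hdx, sub_self, smul_zero]
    have hgdeg : ∀ x ∈ S (i + 1), g x ∈ S (i + c + 1) := by
      intro x hx
      rw [hg]
      refine zsmul_mem (Submodule.sub_mem _ (tt_mem (hφ _ _ hx) (by ring)) ?_) _
      exact tt_mem (hdeg _ _ (h2 _ hx)) (by ring)
    let s' := Av (π ∘ₗ g ∘ₗ σ)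
    have hs' : ∀ x ∈ S (i + 1), s' (d x) = g x := by
      intro x hx
      simp only [s', hAv, LinearMap.comp_apply, ← hdρ]
      have : ∀ h : H, g (σ (d (ρ h⁻¹ x))) = ρ h⁻¹ (g x) := by
        intro h
        have h5 := hσd (ρ h⁻¹ x)
        have h6 : σ (d (ρ h⁻¹ x)) = ρ h⁻¹ x - d (σ (ρ h⁻¹ x)) := by
          rw [eq_sub_iff_add_eq, add_comm]; exact h5
        rw [h6, map_sub, hgρ, hgd (d (σ (ρ h⁻¹ x))) _ (hd2 _), sub_zero]
        exact tt_mem (hdeg _ _ (hσ _ _ (hρS _ _ _ hx))) (by ring)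
      simp only [this]
      exact htr _
    refine ⟨s', ⟨fun h x => hAvρ _ _ _, ?_, ?_⟩, ?_⟩
    · refine hAvdeg _ _ _ ?_
      intro x hx
      exact hπ _ _ (hgdeg _ (hσ _ _ hx))
    · intro x hx hdx
      have h5 := hσd x
      rw [hdx, map_zero, add_zero] at h5
      have h6 := hs' (σ x) (hσ _ _ hx)
      rw [h5] at h6
      rw [h6, hg, map_zsmul, map_sub, hd2, sub_zero, hφd, h5, smul_smul, hε, one_smul]
    · intro x hx
      rw [hs' x hx, hg, smul_smul, hε, one_smul]; abel)
  obtain ⟨t, ht⟩ := tt_glue hS s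
  refine ⟨t, ?_, ?_, ?_, ?_⟩
  · intro h x
    have : t ∘ₗ (ρ h) = (ρ h) ∘ₗ t := by
      refine tt_ext hS _ _ fun i x hx => ?_
      simp only [LinearMap.comp_apply]
      rw [ht i _ (hρS _ _ _ hx), ht i _ hx]
      exact (hsC i).1 h x
    exact LinearMap.congr_fun this x
  · intro i x hx
    rw [ht i x hx]; exact (hsC i).2.1 x hx
  · intro x
    have : d ∘ₗ t + ε • (t ∘ₗ d) = φ := by
      refine tt_ext hS _ _ fun i x hx => ?_
      simp only [LinearMap.add_apply, LinearMap.smul_apply, LinearMap.comp_apply]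
      rw [ht i x hx, ht (i - 1) _ (hdeg _ _ hx)]
      have := hsL (i - 1) x (by simpa using hx)
      simpa using this
    exact LinearMap.congr_fun this x
  · rw [ht (-1) e he, hs_start, hs0e]

end Part1

section Part2

/-- The abstract data extracted from the complete resolution. -/
structure TTData (A M : Type) [CommRing A] [AddCommGroup M] [Module A M] where
  S : ℤ → Submodule A M
  d : M →ₗ[A] M
  e : M
  I : Ideal A
  N : A
  X : Bool → A
  Y : Bool → A
  D : Bool → A
  hd2 : ∀ x, d (d x) = 0
  hdeg : ∀ i, ∀ x ∈ S i, d x ∈ S (i - 1)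
  he_mem : e ∈ S (-1)
  hde : d e = 0
  hne : e ≠ 0
  hinv : ∀ a ∈ I, a • e = 0
  hspan : ∀ x ∈ S (-1), d x = 0 → ∃ a : A, x = a • e
  hlift : ∃ u ∈ S 0, d u = e
  hNI : ∀ a ∈ I, a * N = 0
  hXI : ∀ j, X j ∈ I
  hDI : ∀ j, D j ∈ I
  hXXY : ∀ j, X j * (X j * Y j) = 0
  hN : ∀ j, N = X j * Y j * D j
  hc : ∀ j, ∀ a ∈ I, ∃ b, a * D j = b * (X j * D j)
  hsplit : ∀ a ∈ I, ∃ a1 a2, a1 ∈ I ∧ a2 ∈ I ∧ a = a1 + a2 ∧ a1 * D true = 0 ∧ a2 * D false = 0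
  ha : ∀ i, ∀ x ∈ S i, (∀ a ∈ I, a • x = 0) → ∃ y ∈ S i, x = N • y
  hb : ∀ i, ∀ m ∈ S i, N • m = 0 → m ∈ I • S i
  L1 : ∀ (c ε : ℤ), ε * ε = 1 → ∀ φ : M →ₗ[A] M, (∀ i, ∀ x ∈ S i, φ x ∈ S (i + c)) →
    (∀ x, d (φ x) = ε • φ (d x)) → ∀ z ∈ S c, (∀ a ∈ I, a • z = 0) → d z = φ e →
    ∃ s : M →ₗ[A] M, (∀ i, ∀ x ∈ S i, s x ∈ S (i + c + 1)) ∧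
      (∀ x, d (s x) + ε • s (d x) = φ x) ∧ s e = z
  HD : ∀ (j : Bool) (c : ℤ) (φ : M →ₗ[A] M), (∀ i, ∀ x ∈ S i, φ x ∈ S (i + c)) →
    (∀ x, d (φ x) = φ (d x)) → ∀ m ∈ S c, φ e = d (D j • m) →
    ∀ n, ∀ x ∈ S n, (∀ a ∈ I, a • x = 0) → d x = 0 → ∃ m ∈ S (n + c + 1), φ x = d (D j • m)

namespace TTData

variable {A M : Type} [CommRing A] [AddCommGroup M] [Module A M] (T : TTData A M)

theorem mem {i j : ℤ} {x : M} (h : x ∈ T.S i) (hij : i = j) : x ∈ T.S j := hij ▸ h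

/-- homogeneous chain maps of degree `c` -/
def CM (c : ℤ) (f : M →ₗ[A] M) : Prop :=
  (∀ i, ∀ x ∈ T.S i, f x ∈ T.S (i + c)) ∧ ∀ x, T.d (f x) = f (T.d x)

def Inv (x : M) : Prop := ∀ a ∈ T.I, a • x = 0

def Null (n : ℤ) (z : M) : Prop := ∃ y ∈ T.S (n + 1), z = T.d (T.N • y)

theorem inv_map {x : M} (h : T.Inv x) (f : M →ₗ[A] M) : T.Inv (f x) := fun a ha => by
  rw [← map_smul, h a ha, map_zero]

theorem inv_N (y : M) : T.Inv (T.N • y) := fun a ha => by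
  rw [smul_smul, T.hNI a ha, zero_smul]

theorem N_mem : T.N ∈ T.I := by
  rw [T.hN true]; exact T.I.mul_mem_left _ (T.hDI true)

theorem XY_mem (j : Bool) : T.X j * T.Y j ∈ T.I := T.I.mul_mem_right _ (T.hXI j)

theorem inv_e : T.Inv T.e := T.hinv

/-- elements of the augmentation ideal kill `d (S 0)` -/
theorem kill {a : A} (ha : a ∈ T.I) {y : M} (hy : y ∈ T.S 0) : a • T.d y = 0 := by
  obtain ⟨b, hb⟩ := T.hspan (T.d y) (T.mem (T.hdeg _ _ hy) (by ring)) (T.hd2 y)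
  rw [hb, smul_comm, T.hinv a ha, smul_zero]

theorem null_add {n : ℤ} {z w : M} (hz : T.Null n z) (hw : T.Null n w) : T.Null n (z + w) := by
  obtain ⟨y, hy, rfl⟩ := hz
  obtain ⟨y', hy', rfl⟩ := hw
  exact ⟨y + y', Submodule.add_mem _ hy hy', by rw [smul_add, map_add]⟩

theorem null_smul {n : ℤ} {z : M} (a : A) (hz : T.Null n z) : T.Null n (a • z) := by
  obtain ⟨y, hy, rfl⟩ := hz
  exact ⟨a • y, Submodule.smul_mem _ _ hy, by simp only [map_smul]; rw [smul_comm]⟩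

theorem null_neg {n : ℤ} {z : M} (hz : T.Null n z) : T.Null n (-z) := by
  have := T.null_smul (-1) hz
  simpa using this

theorem null_sub {n : ℤ} {z w : M} (hz : T.Null n z) (hw : T.Null n w) : T.Null n (z - w) := by
  rw [sub_eq_add_neg]; exact T.null_add hz (T.null_neg hw)

theorem null_zero {n : ℤ} : T.Null n 0 := ⟨0, Submodule.zero_mem _, by simp⟩

theorem null_map {n c m : ℤ} {z : M} (hz : T.Null n z) {f : M →ₗ[A] M} (hf : T.CM c f)
    (hm : n + c = m) : T.Null m (f z) := by
  obtain ⟨y, hy, rfl⟩ := hz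
  refine ⟨f y, T.mem (hf.1 _ _ hy) (by rw [← hm]; ring), ?_⟩
  rw [← hf.2, map_smul]

/-- `d` of an invariant is null -/
theorem null_d_inv {n : ℤ} {x : M} (hx : x ∈ T.S (n + 1)) (hi : T.Inv x) : T.Null n (T.d x) := by
  obtain ⟨y, hy, rfl⟩ := T.ha _ _ hx hi
  exact ⟨y, hy, rfl⟩

theorem cm_comp {a b c : ℤ} {f g : M →ₗ[A] M} (hf : T.CM a f) (hg : T.CM b g) (h : b + a = c) :
    T.CM c (f ∘ₗ g) := by
  refine ⟨fun i x hx => T.mem (hf.1 _ _ (hg.1 _ _ hx)) (by rw [← h]; ring), fun x => ?_⟩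
  simp [hf.2, hg.2]

theorem cm_sub {c : ℤ} {f g : M →ₗ[A] M} (hf : T.CM c f) (hg : T.CM c g) : T.CM c (f - g) := by
  refine ⟨fun i x hx => Submodule.sub_mem _ (hf.1 _ _ hx) (hg.1 _ _ hx), fun x => ?_⟩
  simp [hf.2, hg.2]

theorem exists_ext (c : ℤ) (z : M) (hz : z ∈ T.S (c - 1)) (hi : T.Inv z) (hd : T.d z = 0) :
    ∃ f, T.CM c f ∧ f T.e = z := by
  obtain ⟨s, h1, h2, h3⟩ := T.L1 (c - 1) (-1) (by norm_num) 0 (by simp) (by simp) z hz hi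
    (by simpa using hd)
  refine ⟨s, ⟨fun i x hx => T.mem (h1 i x hx) (by ring), fun x => ?_⟩, h3⟩
  have := h2 x
  simp only [neg_smul, one_smul, LinearMap.zero_apply] at this
  exact add_neg_eq_zero.mp this

theorem exists_homotopy (c : ℤ) {f : M →ₗ[A] M} (hf : T.CM c f) (h : T.Null (c - 1) (f T.e)) :
    ∃ s : M →ₗ[A] M, (∀ i, ∀ x ∈ T.S i, s x ∈ T.S (i + c + 1)) ∧
      ∀ x, T.d (s x) + s (T.d x) = f x := by
  obtain ⟨y, hy, hfy⟩ := h
  obtain ⟨s, h1, h2, _⟩ := T.L1 c 1 (by norm_num) f hf.1 (by simpa using hf.2) (T.N • y)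
    (Submodule.smul_mem _ _ (T.mem hy (by ring))) (T.inv_N y) hfy.symm
  exact ⟨s, h1, by simpa using h2⟩

theorem null_comp {c n m : ℤ} {f : M →ₗ[A] M} (hf : T.CM c f) (h : T.Null (c - 1) (f T.e))
    {x : M} (hx : x ∈ T.S n) (hi : T.Inv x) (hd : T.d x = 0) (hm : n + c = m) :
    T.Null m (f x) := by
  obtain ⟨s, h1, h2⟩ := T.exists_homotopy c hf h
  have h3 := h2 x
  rw [hd, map_zero, add_zero] at h3
  rw [← h3]
  exact T.null_d_inv (T.mem (h1 _ _ hx) (by rw [← hm])) (T.inv_map hi s)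

/-- the alternating multipliers -/
def al (j : Bool) (t : Bool) : A := if t then T.X j else T.X j * T.Y j

theorem al_mem (j t : Bool) : T.al j t ∈ T.I := by
  cases t
  · exact T.XY_mem j
  · exact T.hXI j

theorem al_al (j t : Bool) : T.al j t * T.al j (!t) = 0 := by
  cases t
  · simp only [al]; simpa [mul_comm] using T.hXXY j
  · simp only [al]; simpa using T.hXXY j

def par (i : ℕ) : Bool := decide (i % 2 = 0)

theorem par_succ (i : ℕ) : par (i + 1) = !par i := by
  unfold par
  rcases Nat.mod_two_eq_zero_or_one i with h | h <;> simp [h, Nat.add_mod]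

/-- higher homotopies -/
theorem exists_h (j : Bool) : ∃ h : ℕ → (M →ₗ[A] M), h 0 = LinearMap.id ∧
    (∀ (i : ℕ) (n : ℤ), ∀ x ∈ T.S n, h i x ∈ T.S (n + (i : ℤ))) ∧
    ∀ (i : ℕ) x, T.d x = 0 → T.d (h (i + 1) x) = T.al j (par i) • h i x := by
  classical
  -- state: a map, of degree i, with sign
  let C : ℕ → (M →ₗ[A] M) → Prop := fun i f =>
    (∀ n : ℤ, ∀ x ∈ T.S n, f x ∈ T.S (n + (i : ℤ))) ∧
    ∀ x, T.al j (par i) • T.d (f x) = ((-1 : ℤ) ^ i) • T.al j (par i) • f (T.d x)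
  have step : ∀ i f, C i f → ∃ g, C (i + 1) g ∧
      ∀ x, T.d x = 0 → T.d (g x) = T.al j (par i) • f x := by
    rintro i f ⟨h1, h2⟩
    obtain ⟨s, s1, s2, _⟩ := T.L1 i ((-1) ^ i) (by rw [← mul_pow]; simp) (T.al j (par i) • f)
      (fun n x hx => Submodule.smul_mem _ _ (h1 n x hx))
      (fun x => by simpa using h2 x) 0 (Submodule.zero_mem _) (by simp)
      (by
        rw [map_zero, LinearMap.smul_apply]
        exact (T.inv_map T.inv_e f _ (T.al_mem j _)).symm)
    refine ⟨s, ⟨fun n x hx => T.mem (s1 n x hx) (by push_cast; ring), fun x => ?_⟩, fun x hx => ?_⟩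
    · have h3 := s2 x
      have h4 : T.d (s x) = T.al j (par i) • f x - ((-1 : ℤ) ^ i) • s (T.d x) := by
        rw [eq_sub_iff_add_eq]; exact h3
      rw [h4, smul_sub, smul_smul, par_succ]
      have h5 : T.al j (!par i) * T.al j (par i) = 0 := by rw [mul_comm]; exact T.al_al _ _
      rw [h5, zero_smul, zero_sub, pow_succ, smul_comm]
      simp
    · have h3 := s2 x
      rw [hx, map_zero, smul_zero, add_zero] at h3
      exact h3
  have h0 : C 0 LinearMap.id := ⟨by simp, by simp⟩
  choose! g hg1 hg2 using step
  let h : ℕ → (M →ₗ[A] M) := fun i => Nat.rec LinearMap.id (fun m a => g m a) i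
  have hh : ∀ i, C i (h i) := by
    intro i
    induction i with
    | zero => exact h0
    | succ i ih => exact hg1 i _ ih
  exact ⟨h, rfl, fun i => (hh i).1, fun i => hg2 i _ (hh i)⟩

/-- `w` extends upwards to an infinite chain -/
def Up (j : Bool) (t : Bool) (n : ℤ) (w : M) : Prop :=
  ∃ u : ℕ → M, u 0 = T.D j • w ∧ (∀ i : ℕ, ∃ m ∈ T.S (n + (i : ℤ)), u i = T.D j • m) ∧
    ∀ i : ℕ, T.d (u (i + 1)) = T.al j (if par i then t else !t) • u i

theorem up_add {j t : Bool} {n : ℤ} {w w' : M} (h : T.Up j t n w) (h' : T.Up j t n w') :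
    T.Up j t n (w + w') := by
  obtain ⟨u, u0, u1, u2⟩ := h
  obtain ⟨v, v0, v1, v2⟩ := h'
  refine ⟨fun i => u i + v i, by simp [u0, v0], fun i => ?_, fun i => ?_⟩
  · obtain ⟨m, hm, hm'⟩ := u1 i
    obtain ⟨m', hmm, hmm'⟩ := v1 i
    exact ⟨m + m', Submodule.add_mem _ hm hmm, by beta_reduce; rw [hm', hmm', smul_add]⟩
  · rw [map_add, u2, v2, smul_add]

theorem up_cycle (j t : Bool) {n : ℤ} {w : M} (hw : w ∈ T.S n) (hd : T.d (T.D j • w) = 0) :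
    T.Up j t n w := by
  obtain ⟨h, h0, h1, h2⟩ := T.exists_h j
  cases t
  · -- first multiplier `X * Y`
    refine ⟨fun i => (if par i then (1 : A) else T.Y j) • h i (T.D j • w), by simp [h0, par],
      fun i => ⟨(if par i then (1 : A) else T.Y j) • h i w,
        Submodule.smul_mem _ _ (h1 _ _ _ hw), ?_⟩, fun i => ?_⟩
    · beta_reduce; rw [map_smul, smul_comm]
    · rw [map_smul, h2 i _ hd, par_succ]
      cases hp : par i
      · simp [al, hp, smul_smul, mul_assoc]
      · simp [al, hp, smul_smul, mul_assoc, mul_left_comm]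
  · refine ⟨fun i => h i (T.D j • w), by simp [h0],
      fun i => ⟨h i w, h1 _ _ _ hw, ?_⟩, fun i => ?_⟩
    · beta_reduce; rw [map_smul]
    · rw [h2 i _ hd]
      cases hp : par i <;> simp

/-- division: an element of `D • S i` killed by one multiplier is a multiple of the other -/
theorem div (j t : Bool) {i : ℤ} {m : M} (hm : m ∈ T.S i) (h : T.al j t • T.D j • m = 0) :
    ∃ m' ∈ T.S i, T.D j • m = T.al j (!t) • T.D j • m' := by
  cases t
  · have h1 : T.N • m = 0 := by
      rw [T.hN j, mul_smul]; simpa [al] using h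
    have h2 := T.hb i m hm h1
    refine Submodule.smul_induction_on h2 ?_ ?_
    · intro a ha n hn
      obtain ⟨b, hb⟩ := T.hc j a ha
      refine ⟨b • n, Submodule.smul_mem _ _ hn, ?_⟩
      simp only [al, smul_smul]
      congr 1
      rw [mul_comm, hb]; simp; ring
    · rintro x y ⟨x', hx', hx⟩ ⟨y', hy', hy⟩
      exact ⟨x' + y', Submodule.add_mem _ hx' hy', by rw [smul_add, hx, hy, smul_add, smul_add]⟩
  · have h1 : T.Inv (T.D j • m) := by
      intro a ha
      obtain ⟨b, hb⟩ := T.hc j a ha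
      rw [smul_smul, hb, mul_smul, mul_smul]
      have : T.X j • T.D j • m = 0 := by simpa [al] using h
      rw [this, smul_zero]
    obtain ⟨y, hy, hy'⟩ := T.ha i _ (Submodule.smul_mem _ _ hm) h1
    refine ⟨y, hy, ?_⟩
    rw [hy', T.hN j, mul_smul]
    simp [al]

theorem up_all (j : Bool) : ∀ (n : ℕ) (t : Bool) (w : M), w ∈ T.S n →
    T.al j t • T.d (T.D j • w) = 0 → T.Up j t n w := by
  intro n
  induction n with
  | zero =>
    intro t w hw _
    refine T.up_cycle j t hw ?_
    rw [map_smul]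
    exact T.kill (T.hDI j) (by simpa using hw)
  | succ n ih =>
    intro t w hw h
    have hdw : T.d w ∈ T.S n := T.mem (T.hdeg _ _ hw) (by push_cast; ring)
    rw [map_smul] at h
    obtain ⟨w1, hw1, h1⟩ := T.div j t hdw h
    have h2 : T.al j (!t) • T.d (T.D j • w1) = 0 := by
      rw [← map_smul, ← h1, ← map_smul, T.hd2]
    obtain ⟨u, u0, u1, u2⟩ := ih (!t) w1 hw1 h2
    obtain ⟨m, hm, hm'⟩ := u1 1
    have hm2 : m ∈ T.S ((n + 1 : ℕ) : ℤ) := T.mem hm (by push_cast; ring)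
    have hd1 : T.d (T.D j • m) = T.al j (!t) • T.D j • w1 := by
      rw [← hm', u2 0, u0]; simp [par]
    have e1 : T.Up j t ((n + 1 : ℕ) : ℤ) m := by
      refine ⟨fun i => u (i + 1), hm', fun i => ?_, fun i => ?_⟩
      · obtain ⟨m', h3, h4⟩ := u1 (i + 1)
        exact ⟨m', T.mem h3 (by push_cast; ring), h4⟩
      · rw [u2 (i + 1), par_succ]
        cases par i <;> simp
    have e2 : T.Up j t ((n + 1 : ℕ) : ℤ) (w - m) := by
      refine T.up_cycle j t (Submodule.sub_mem _ hw hm2) ?_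
      rw [smul_sub, map_sub, hd1, map_smul, h1, sub_self]
    have := T.up_add e2 e1
    rwa [sub_add_cancel] at this

/-- The key divisibility statement. -/
theorem K3 (j : Bool) {n : ℤ} (hn : 0 ≤ n) {z : M} (hz : z ∈ T.S n) (hi : T.Inv z)
    (hd : T.d z = 0) : ∃ u' ∈ T.S (n + 1), ∃ u ∈ T.S (n + 2),
      z = T.d (T.D j • u') ∧ T.X j • T.D j • u' = T.d (T.D j • u) := by
  obtain ⟨m, rfl⟩ := Int.eq_ofNat_of_zero_le hn
  obtain ⟨y, hy, rfl⟩ := T.ha _ _ hz hi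
  have h1 : T.al j false • T.D j • y = T.N • y := by
    rw [T.hN j, mul_smul]; simp [al]
  obtain ⟨u, u0, u1, u2⟩ := T.up_all j m false y hy (by rw [← map_smul, h1, hd])
  obtain ⟨a, ha, ha'⟩ := u1 1
  obtain ⟨b, hb, hb'⟩ := u1 2
  refine ⟨a, by simpa using ha, b, by simpa using hb, ?_, ?_⟩
  · rw [← ha', u2 0, u0, ← h1]; simp [par]
  · rw [← ha', ← hb', u2 1]; simp [par, al]

/-- The degree two class, with the data defining it. -/
theorem exists_zeta (j : Bool) : ∃ (ζ : M →ₗ[A] M) (w w' : M), T.CM (-2) ζ ∧ w ∈ T.S (-1) ∧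
    w' ∈ T.S (-2) ∧ T.e = T.N • w ∧ T.d (T.D j • w) = T.X j • T.D j • w' ∧
    ζ T.e = T.d (T.D j • w') := by
  obtain ⟨w, hw, he⟩ := T.ha _ _ T.he_mem T.inv_e
  have hdw : T.d w ∈ T.S (-2) := T.mem (T.hdeg _ _ hw) (by ring)
  have h1 : T.al j false • T.D j • T.d w = 0 := by
    have := T.hde
    rw [he, T.hN j, mul_smul, map_smul, map_smul] at this
    simpa [al] using this
  obtain ⟨w', hw', h2⟩ := T.div j false hdw h1
  have h3 : T.d (T.D j • w) = T.X j • T.D j • w' := by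
    rw [map_smul, h2]; simp [al]
  obtain ⟨ζ, hζ, hζe⟩ := T.exists_ext (-2) (T.d (T.D j • w'))
    (T.hdeg _ _ (Submodule.smul_mem _ _ hw')) (by
      intro a ha
      obtain ⟨b, hb⟩ := T.hc j a ha
      rw [← map_smul, smul_smul, hb, mul_smul, mul_smul, ← h3, ← map_smul, map_smul, map_smul,
        T.hd2, smul_zero]) (T.hd2 _)
  exact ⟨ζ, w, w', hζ, hw, hw', he, h3, hζe⟩

theorem factor (j : Bool) {ζ : M →ₗ[A] M} {w w' : M} (hw : w ∈ T.S (-1))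
    (hw' : w' ∈ T.S (-2)) (he : T.e = T.N • w) (hdw : T.d (T.D j • w) = T.X j • T.D j • w')
    (hζe : ζ T.e = T.d (T.D j • w')) {c : ℤ} (hc : 1 ≤ c) {g : M →ₗ[A] M} (hg : T.CM c g) :
    ∃ g', T.CM (c + 2) g' ∧ T.Null (c - 1) (g T.e - g' (ζ T.e)) := by
  have hgz : g T.e ∈ T.S (c - 1) := T.mem (hg.1 _ _ T.he_mem) (by ring)
  obtain ⟨u', hu', u, hu, h1, h2⟩ := T.K3 j (by omega : 0 ≤ c - 1) hgz (T.inv_map T.inv_e g)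
    (by rw [hg.2, T.hde, map_zero])
  have hu2 : u ∈ T.S (c + 2 - 1) := T.mem hu (by ring)
  obtain ⟨g', hg', hg'e⟩ := T.exists_ext (c + 2) (T.N • u) (Submodule.smul_mem _ _ hu2)
    (T.inv_N u) (by
      rw [T.hN j, mul_smul, map_smul, ← h2, smul_smul]
      have : T.X j * T.Y j * T.X j = 0 := by rw [mul_comm]; exact T.hXXY j
      rw [this, zero_smul])
  refine ⟨g', hg', ?_⟩
  -- compare `g' (D w)` with `D u`
  have k1 : g' w - u ∈ T.S (c + 1) :=
    Submodule.sub_mem _ (T.mem (hg'.1 _ _ hw) (by ring)) (T.mem hu (by ring))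
  have k2 : T.al j false • T.D j • (g' w - u) = 0 := by
    have : T.al j false • T.D j • (g' w - u) = T.N • (g' w - u) := by
      rw [T.hN j, mul_smul]; simp [al]
    rw [this, smul_sub, ← map_smul, ← he, hg'e, sub_self]
  obtain ⟨m1, hm1, k3⟩ := T.div j false k1 k2
  have k3' : T.D j • g' w - T.D j • u = T.X j • T.D j • m1 := by
    rw [← smul_sub, k3]; simp [al]
  have k4 := congrArg T.d k3'
  rw [map_sub, ← map_smul, hg'.2, hdw, map_smul, ← h2, map_smul, map_smul T.d, map_smul T.d] at k4
  have k5 : g' w' - u' - T.d m1 ∈ T.S c := by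
    refine Submodule.sub_mem _ (Submodule.sub_mem _ ?_ ?_) ?_
    · exact T.mem (hg'.1 _ _ hw') (by ring)
    · exact T.mem hu' (by ring)
    · exact T.mem (T.hdeg _ _ hm1) (by ring)
  have k6 : T.al j true • T.D j • (g' w' - u' - T.d m1) = 0 := by
    simp only [al, if_true, smul_sub]
    rw [k4]; simp
  obtain ⟨m2, hm2, k7⟩ := T.div j true k5 k6
  have k8 : T.D j • (g' w' - u' - T.d m1) = T.N • m2 := by
    rw [k7, T.hN j, mul_smul]; simp [al]
  refine ⟨-m2, Submodule.neg_mem _ (T.mem hm2 (by ring)), ?_⟩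
  rw [smul_neg, ← k8, hζe, ← hg'.2, map_smul g', h1]
  simp only [smul_sub, map_neg, map_sub, map_smul, T.hd2, smul_zero]
  abel

theorem cm_inv_cycle {c : ℤ} {f : M →ₗ[A] M} (hf : T.CM c f) :
    f T.e ∈ T.S (c - 1) ∧ T.Inv (f T.e) ∧ T.d (f T.e) = 0 :=
  ⟨T.mem (hf.1 _ _ T.he_mem) (by ring), T.inv_map T.inv_e f, by rw [hf.2, T.hde, map_zero]⟩

/-- Products of classes of positive homological degree vanish. -/
theorem product : ∀ (n : ℕ) (a b : ℤ), 1 ≤ a → 1 ≤ b → a ≤ n → ∀ f g : M →ₗ[A] M, T.CM a f →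
    T.CM b g → T.Null (a + b - 1) (g (f T.e)) := by
  obtain ⟨ζ, w, w', hζ, hw, hw', he, hdw, hζe⟩ := T.exists_zeta true
  intro n
  induction n with
  | zero => intro a b ha hb hn; exfalso; push_cast at hn; omega
  | succ n ih =>
    intro a b ha hb hn f g hf hg
    obtain ⟨g', hg', hnull⟩ := T.factor true hw hw' he hdw hζe hb hg
    have hgz : T.CM b (g' ∘ₗ ζ) := T.cm_comp hg' hζ (by ring)
    obtain ⟨f1, f2, f3⟩ := T.cm_inv_cycle hf
    have h1 : T.Null (a + b - 1) ((g - g' ∘ₗ ζ) (f T.e)) :=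
      T.null_comp (T.cm_sub hg hgz) (by simpa using hnull) f1 f2 f3 (by ring)
    have hh : T.CM (a - 2) (ζ ∘ₗ f) := T.cm_comp hζ hf (by ring)
    suffices h2 : T.Null (a + b - 1) (g' (ζ (f T.e))) by
      have := T.null_add h1 h2
      simpa using this
    rcases le_or_gt 3 a with ha3 | ha3
    · have := ih (a - 2) (b + 2) (by omega) (by omega) (by push_cast at hn; omega) _ _ hh hg'
      have e1 : a - 2 + (b + 2) - 1 = a + b - 1 := by ring
      rwa [e1] at this
    · suffices h3 : T.Null (a - 3) (ζ (f T.e)) from T.null_map h3 hg' (by ring)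
      obtain ⟨m, hm, hm'⟩ := T.HD true (-2) ζ hζ.1 hζ.2 w' hw' hζe (a - 1) (f T.e) f1 f2 f3
      rcases (by omega : a = 2 ∨ a = 1) with rfl | rfl
      · have : ζ (f T.e) = 0 := by
          rw [hm', map_smul]
          exact T.kill (T.hDI true) (T.mem hm (by norm_num))
        rw [this]
        exact T.null_zero
      · obtain ⟨ξ, v, v', hξ, hv, hv', hve, hdv, hξe⟩ := T.exists_zeta false
        obtain ⟨f', hf', y, hy, hyy⟩ := T.factor false hv hv' hve hdv hξe le_rfl hf
        have e1 : ζ (f T.e) = T.d (T.D false • (ζ (f' v') + (T.X false * T.Y false) • ζ y)) := by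
          have : f T.e = f' (ξ T.e) + T.d (T.N • y) := by rw [← hyy]; abel
          rw [this, map_add, hξe, ← hf'.2, ← hζ.2, ← hζ.2, smul_add, map_add, smul_smul,
            mul_comm (T.D false), ← T.hN false]
          simp only [map_smul]
        set q := ζ (f' v') + (T.X false * T.Y false) • ζ y with hq
        have hqm : q ∈ T.S (-1) := by
          refine Submodule.add_mem _ ?_ (Submodule.smul_mem _ _ ?_)
          · exact T.mem (hζ.1 _ _ (hf'.1 _ _ hv')) (by norm_num)
          · exact T.mem (hζ.1 _ _ hy) (by norm_num)
        have hm1 : m ∈ T.S (-1) := T.mem hm (by norm_num)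
        have hdiff : T.d (T.D true • m - T.D false • q) = 0 := by
          rw [map_sub, ← hm', ← e1, sub_self]
        obtain ⟨a0, ha0⟩ := T.hspan _ (Submodule.sub_mem _ (Submodule.smul_mem _ _ hm1)
          (Submodule.smul_mem _ _ hqm)) hdiff
        have hInv : T.Inv (T.D true • m) := by
          intro b0 hb0
          obtain ⟨b1, b2, hb1, hb2, rfl, e3, e4⟩ := T.hsplit b0 hb0
          rw [add_smul, smul_smul, e3, zero_smul, zero_add]
          have : T.D true • m = a0 • T.e + T.D false • q := by rw [← ha0]; abel
          rw [this, smul_add, smul_comm, T.hinv b2 hb2, smul_zero, smul_smul, e4]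
          simp
        rw [hm']
        exact T.null_d_inv (T.mem (Submodule.smul_mem _ _ hm1) (by norm_num)) hInv

/-- Nonvanishing in arbitrarily large degrees. -/
theorem nonvanishing : ∀ n : ℕ, ∃ (c : ℤ) (f : M →ₗ[A] M), n < c ∧ T.CM c f ∧
    ¬ T.Null (c - 1) (f T.e) := by
  obtain ⟨ζ, w, w', hζ, hw, hw', he, hdw, hζe⟩ := T.exists_zeta true
  intro n
  induction n with
  | zero =>
    obtain ⟨u, hu, hue⟩ := T.hlift
    obtain ⟨f, hf, hfe⟩ := T.exists_ext 1 (T.N • u) (Submodule.smul_mem _ _ (T.mem hu (by ring)))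
      (T.inv_N u) (by rw [map_smul, hue, T.hinv _ T.N_mem])
    refine ⟨1, f, by norm_num, hf, ?_⟩
    rintro ⟨y, hy, hyy⟩
    have hdy : T.d y ∈ T.S 0 := T.mem (T.hdeg _ _ hy) (by ring)
    have h1 : T.N • (u - T.d y) = 0 := by
      rw [smul_sub, ← hfe, hyy, map_smul, sub_self]
    have h2 := T.hb 0 _ (Submodule.sub_mem _ hu hdy) h1
    have h3 : T.d (u - T.d y) = 0 := by
      refine Submodule.smul_induction_on h2 ?_ ?_
      · intro a ha m hm
        rw [map_smul]; exact T.kill ha hm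
      · intro x y hx hy
        rw [map_add, hx, hy, add_zero]
    rw [map_sub, hue, T.hd2, sub_zero] at h3
    exact T.hne h3
  | succ n ih =>
    obtain ⟨c, f, hc, hf, hfn⟩ := ih
    obtain ⟨f', hf', hnull⟩ := T.factor true hw hw' he hdw hζe (by omega) hf
    refine ⟨c + 2, f', by push_cast; omega, hf', fun h => hfn ?_⟩
    obtain ⟨z1, z2, z3⟩ := T.cm_inv_cycle hζ
    have h1 := T.null_comp hf' h z1 z2 z3 (by ring : (-2 - 1) + (c + 2) = c - 1)
    have := T.null_add hnull h1
    simpa using this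

end TTData

end Part2

section Part3

theorem tt_comp {A M : Type} [CommRing A] [AddCommGroup M] [Module A M]
    {S : ℤ → Submodule A M} (hS : DirectSum.IsInternal S) :
    ∃ cp : ℤ → ((M →ₗ[A] M) →ₗ[A] (M →ₗ[A] M)),
      (∀ c f i, ∀ x ∈ S i, cp c f x ∈ S (i + c)) ∧
      (∀ c f, (∀ i, ∀ x ∈ S i, f x ∈ S (i + c)) → cp c f = f ∧ ∀ c', c' ≠ c → cp c' f = 0) ∧
      (∀ d : M →ₗ[A] M, (∀ i, ∀ x ∈ S i, d x ∈ S (i - 1)) → ∀ c s,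
        cp c (d ∘ₗ s) = d ∘ₗ cp (c + 1) s ∧ cp c (s ∘ₗ d) = cp (c + 1) s ∘ₗ d) := by
  obtain ⟨pr, hp1, hp2, hp3⟩ := tt_pr hS
  have hg : ∀ (c : ℤ) (f : M →ₗ[A] M), ∃ t : M →ₗ[A] M, ∀ i, ∀ x ∈ S i,
      t x = pr (i + c) (f x) := fun c f => tt_glue hS (fun i => pr (i + c) ∘ₗ f)
  choose cp hcp using hg
  refine ⟨fun c => ⟨⟨cp c, fun f g => ?_⟩, fun a f => ?_⟩, ?_, ?_, ?_⟩
  · refine tt_ext hS _ _ fun i x hx => ?_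
    simp [hcp c _ i x hx]
  · refine tt_ext hS _ _ fun i x hx => ?_
    simp [hcp c _ i x hx]
  · intro c f i x hx
    show cp c f x ∈ _
    rw [hcp c f i x hx]; exact hp1 _ _
  · intro c f hf
    refine ⟨tt_ext hS _ _ fun i x hx => ?_, fun c' hc' => tt_ext hS _ _ fun i x hx => ?_⟩
    · show cp c f x = _
      rw [hcp c f i x hx]; exact hp2 _ _ (hf i x hx)
    · show cp c' f x = _
      rw [hcp c' f i x hx]
      exact hp3 (i + c) (i + c') (by omega) _ (hf i x hx)
  · intro d hd c s
    have hprd : ∀ j x, pr j (d x) = d (pr (j + 1) x) := by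
      intro j x
      have : pr j ∘ₗ d = d ∘ₗ pr (j + 1) := by
        refine tt_ext hS _ _ fun i x hx => ?_
        show pr j (d x) = d (pr (j + 1) x)
        by_cases h : i = j + 1
        · subst h
          rw [hp2 _ _ hx]; exact hp2 _ _ (tt_mem (hd _ _ hx) (by ring))
        · rw [hp3 i (j + 1) h _ hx, map_zero]
          exact hp3 (i - 1) j (by omega) _ (hd _ _ hx)
      exact LinearMap.congr_fun this x
    refine ⟨tt_ext hS _ _ fun i x hx => ?_, tt_ext hS _ _ fun i x hx => ?_⟩
    · show cp c (d ∘ₗ s) x = d (cp (c + 1) s x)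
      rw [hcp c _ i x hx, hcp (c + 1) _ i x hx, LinearMap.comp_apply, hprd, add_assoc]
    · show cp c (s ∘ₗ d) x = cp (c + 1) s (d x)
      rw [hcp c _ i x hx, hcp (c + 1) _ (i - 1) (d x) (hd _ _ hx), LinearMap.comp_apply]
      congr 2
      ring

theorem tt_conclude {k A M R : Type} [Field k] [CommRing A] [Algebra k A] [AddCommGroup M]
    [Module k M] [Module A M] [IsScalarTower k A M] [SMulCommClass A k M]
    (T : TTData A M) (hS : DirectSum.IsInternal T.S)
    (hspan : ∀ x ∈ T.S (-1), T.d x = 0 → ∃ c : k, x = c • T.e)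
    [Ring R] [Algebra k R] (q : (M →ₗ[A] M) → R) (Good : (M →ₗ[A] M) → Prop)
    (hGood : ∀ f, Good f ↔ (f ∘ₗ T.d = T.d ∘ₗ f ∧
        ∃ (c0 : Finset ℤ) (F : ℤ → (M →ₗ[A] M)),
          (∀ c ∈ c0, 0 ≤ c) ∧
          (∀ c ∈ c0, ∀ (i : ℤ), ∀ x ∈ T.S i, F c x ∈ T.S (i + c)) ∧
          f = ∑ c ∈ c0, F c))
    (hq1 : q 1 = 1)
    (hqadd : ∀ f g, Good f → Good g → q (f + g) = q f + q g)
    (hqmul : ∀ f g, Good f → Good g → q (f ∘ₗ g) = q f * q g)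
    (hqsmul : ∀ (c : k) (f), Good f → q (c • f) = algebraMap k R c * q f)
    (hqsurj : ∀ y : R, ∃ f, Good f ∧ q f = y)
    (hqker : ∀ f g, Good f → Good g →
      (q f = q g ↔ ∃ s : M →ₗ[A] M,
        (∀ (i : ℤ), ∀ x ∈ T.S i, s x ∈ ⨆ (j : ℤ) (_ : i + 1 ≤ j), T.S j) ∧
        f - g = T.d ∘ₗ s + s ∘ₗ T.d)) :
    IsLocalRing R ∧
    (∀ x y : R, ¬IsUnit x → ¬IsUnit y → x * y = 0) ∧
    ¬∃ fs : Finset R, (∀ x ∈ fs, ¬IsUnit x) ∧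
      (∀ x : R, ¬IsUnit x → x ∈ Ideal.span (fs : Set R)) := by
  classical
  obtain ⟨cp, cdeg, chom, cd⟩ := tt_comp hS
  have cd := cd T.d T.hdeg
  -- structure of good maps
  have gfin : ∀ f, Good f → ∃ c0 : Finset ℤ, (∀ c ∈ c0, 0 ≤ c) ∧ (∀ c, c ∉ c0 → cp c f = 0) ∧
      ∀ c1, c0 ⊆ c1 → f = ∑ c ∈ c1, cp c f := by
    intro f hf
    obtain ⟨-, c0, F, h1, h2, h3⟩ := (hGood f).1 hf
    have key : ∀ c, cp c f = if c ∈ c0 then F c else 0 := by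
      intro c
      rw [h3, map_sum]
      split_ifs with h
      · rw [Finset.sum_eq_single c]
        · exact (chom c _ (h2 c h)).1
        · intro b hb hbc
          exact (chom b _ (h2 b hb)).2 c hbc.symm
        · exact fun h' => absurd h h'
      · refine Finset.sum_eq_zero fun b hb => (chom b _ (h2 b hb)).2 c ?_
        rintro rfl; exact h hb
    have hz : ∀ c, c ∉ c0 → cp c f = 0 := fun c hc => by rw [key, if_neg hc]
    refine ⟨c0, h1, hz, fun c1 hc1 => ?_⟩
    rw [← Finset.sum_subset hc1 fun c _ hc => hz c hc]
    conv_lhs => rw [h3]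
    exact Finset.sum_congr rfl fun c hc => by rw [key, if_pos hc]
  have gmk : ∀ f : M →ₗ[A] M, (∀ x, T.d (f x) = f (T.d x)) → ∀ c0 : Finset ℤ,
      (∀ c ∈ c0, 0 ≤ c) → f = ∑ c ∈ c0, cp c f → Good f := fun f h1 c0 h2 h3 =>
    (hGood f).2 ⟨LinearMap.ext fun x => (h1 x).symm, c0, fun c => cp c f, h2,
      fun c _ => cdeg c f, h3⟩
  have gcm : ∀ f, Good f → ∀ x, T.d (f x) = f (T.d x) := fun f hf x =>
    (LinearMap.congr_fun ((hGood f).1 hf).1 x).symm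
  have gcp : ∀ f, Good f → ∀ c, T.CM c (cp c f) := by
    intro f hf c
    refine ⟨cdeg c f, fun x => ?_⟩
    have h1 := (cd (c - 1) f).1
    have h2 := (cd (c - 1) f).2
    rw [((hGood f).1 hf).1, h1, sub_add_cancel] at h2
    exact LinearMap.congr_fun h2 x
  have ghom : ∀ c f, 0 ≤ c → T.CM c f → Good f := fun c f hc hf =>
    gmk f hf.2 {c} (by simpa using hc) (by simpa using (chom c f hf.1).1.symm)
  have gadd : ∀ f g, Good f → Good g → Good (f + g) := by
    intro f g hf hg
    obtain ⟨c0, h1, h2, h3⟩ := gfin f hf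
    obtain ⟨c1, h1', h2', h3'⟩ := gfin g hg
    refine gmk _ (fun x => by simp [gcm f hf, gcm g hg]) (c0 ∪ c1) ?_ ?_
    · intro c hc
      rcases Finset.mem_union.1 hc with h | h
      · exact h1 c h
      · exact h1' c h
    · simp only [map_add]
      rw [Finset.sum_add_distrib, ← h3 _ Finset.subset_union_left,
        ← h3' _ Finset.subset_union_right]
  have gsm : ∀ (a : A) f, Good f → Good (a • f) := by
    intro a f hf
    obtain ⟨c0, h1, h2, h3⟩ := gfin f hf
    refine gmk _ (fun x => by simp [gcm f hf]) c0 h1 ?_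
    simp only [map_smul]
    rw [← Finset.smul_sum, ← h3 _ subset_rfl]
  have hsm : ∀ (c : k) (f : M →ₗ[A] M), c • f = algebraMap k A c • f := fun c f =>
    LinearMap.ext fun x => by simp
  have g0 : Good 0 := ghom 0 0 le_rfl ⟨by simp, by simp⟩
  have g1 : Good 1 := ghom 0 1 le_rfl ⟨by simp, by simp⟩
  have cp1 : cp 0 1 = 1 := (chom 0 1 (by simp)).1
  have q0 : q 0 = 0 := by
    have := hqadd 0 0 g0 g0
    rw [add_zero] at this
    simpa using this
  have qsum : ∀ (c0 : Finset ℤ) (F : ℤ → (M →ₗ[A] M)), (∀ c ∈ c0, Good (F c)) →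
      Good (∑ c ∈ c0, F c) ∧ q (∑ c ∈ c0, F c) = ∑ c ∈ c0, q (F c) := by
    intro c0 F
    induction c0 using Finset.induction_on with
    | empty => intro _; simpa using ⟨g0, q0⟩
    | insert a s ha ih =>
      intro h
      obtain ⟨i1, i2⟩ := ih fun c hc => h c (Finset.mem_insert_of_mem hc)
      have h3 := h a (Finset.mem_insert_self _ _)
      rw [Finset.sum_insert ha, Finset.sum_insert ha]
      exact ⟨gadd _ _ h3 i1, by rw [hqadd _ _ h3 i1, i2]⟩
  have qnull : ∀ c f, 0 ≤ c → T.CM c f → T.Null (c - 1) (f T.e) → q f = 0 := by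
    intro c f hc hf hn
    obtain ⟨s, s1, s2⟩ := T.exists_homotopy c hf hn
    rw [← q0]
    refine (hqker f 0 (ghom c f hc hf) g0).2 ⟨s, fun i x hx => ?_, ?_⟩
    · exact Submodule.mem_iSup_of_mem (i + c + 1)
        (Submodule.mem_iSup_of_mem (by omega) (s1 i x hx))
    · ext x; simpa using (s2 x).symm
  have nullq : ∀ f g, Good f → Good g → q f = q g → ∀ c,
      T.Null (c - 1) (cp c f T.e - cp c g T.e) := by
    intro f g hf hg h c
    obtain ⟨s, -, hs⟩ := (hqker f g hf hg).1 h
    have h1 := congrArg (cp c) hs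
    rw [map_sub, map_add, (cd c s).1, (cd c s).2] at h1
    have h2 := LinearMap.congr_fun h1 T.e
    simp only [LinearMap.sub_apply, LinearMap.add_apply, LinearMap.comp_apply, T.hde, map_zero,
      add_zero] at h2
    rw [h2]
    refine T.null_d_inv (T.mem (cdeg (c + 1) s _ _ T.he_mem) (by ring)) (T.inv_map T.inv_e _)
  -- the maximal ideal
  let P0 : R → Prop := fun y => ∃ f, Good f ∧ q f = y ∧ cp 0 f T.e = 0
  have hnt : (1 : R) ≠ 0 := by
    intro h
    have := nullq 1 0 g1 g0 (by rw [hq1, q0, h]) 0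
    rw [cp1] at this
    obtain ⟨y, hy, h2⟩ := this
    rw [map_smul, T.kill T.N_mem (T.mem hy (by norm_num))] at h2
    exact T.hne (by simpa using h2)
  have : Nontrivial R := ⟨1, 0, hnt⟩
  have hprod : ∀ x y, P0 x → P0 y → x * y = 0 := by
    rintro _ _ ⟨f, hf, rfl, hf0⟩ ⟨g, hg, rfl, hg0⟩
    obtain ⟨c0, h1, -, h3⟩ := gfin f hf
    obtain ⟨c1, h1', -, h3'⟩ := gfin g hg
    have gf := fun c (hc : c ∈ c0) => ghom c _ (h1 c hc) (gcp f hf c)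
    have gg := fun c (hc : c ∈ c1) => ghom c _ (h1' c hc) (gcp g hg c)
    rw [h3 _ subset_rfl, h3' _ subset_rfl, (qsum c0 _ gf).2, (qsum c1 _ gg).2, Finset.sum_mul_sum]
    refine Finset.sum_eq_zero fun a ha => Finset.sum_eq_zero fun b hb => ?_
    rcases (h1 a ha).eq_or_lt with rfl | ha'
    · rw [qnull 0 _ le_rfl (gcp f hf 0) (by rw [hf0]; exact T.null_zero), zero_mul]
    rcases (h1' b hb).eq_or_lt with rfl | hb'
    · rw [qnull 0 (cp 0 g) le_rfl (gcp g hg 0) (by rw [hg0]; exact T.null_zero), mul_zero]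
    rw [← hqmul _ _ (gf a ha) (gg b hb)]
    refine qnull (b + a) _ (by omega) (T.cm_comp (gcp f hf a) (gcp g hg b) rfl) ?_
    exact T.product b.toNat b a (by omega) (by omega) (by omega) _ _ (gcp g hg b) (gcp f hf a)
  have hdec : ∀ y, ∃ (l : k) (m : R), P0 m ∧ y = algebraMap k R l + m := by
    intro y
    obtain ⟨f, hf, rfl⟩ := hqsurj y
    obtain ⟨z1, z2, z3⟩ := T.cm_inv_cycle (gcp f hf 0)
    obtain ⟨l, hl⟩ := hspan _ (T.mem z1 (by norm_num)) z3
    have gm : Good ((-l) • (1 : M →ₗ[A] M)) := by rw [hsm]; exact gsm _ _ g1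
    refine ⟨l, q (f + (-l) • 1), ⟨_, gadd _ _ hf gm, rfl, ?_⟩, ?_⟩
    · rw [map_add, hsm, map_smul, cp1]
      simp [hl]
    · rw [hqadd _ _ hf gm, hqsmul _ _ g1, hq1]; simp
  have hnu : ∀ y, P0 y → ¬ IsUnit y := by
    intro y hy hu
    have := hprod y y hy hy
    have h2 : y = 0 := by simpa using (hu.mul_right_eq_zero).1 this
    rw [h2] at hu
    exact not_isUnit_zero hu
  have hun : ∀ y, ¬ IsUnit y → P0 y := by
    intro y hy
    obtain ⟨l, m, hm, rfl⟩ := hdec y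
    by_cases hl : l = 0
    · subst hl; simpa using hm
    · exfalso; apply hy
      have h1 : algebraMap k R l + m = algebraMap k R l * (1 + algebraMap k R l⁻¹ * m) := by
        rw [mul_add, mul_one, ← mul_assoc, ← map_mul, mul_inv_cancel₀ hl, map_one, one_mul]
      rw [h1]
      refine IsUnit.mul ((IsUnit.mk0 l hl).map _) ?_
      refine IsNilpotent.isUnit_one_add ⟨2, ?_⟩
      rw [pow_two, mul_assoc, ← mul_assoc m, ← Algebra.commutes, mul_assoc, hprod m m hm hm]
      simp
  refine ⟨⟨?_⟩, fun x y hx hy => hprod x y (hun x hx) (hun y hy), ?_⟩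
  · intro a b hab
    by_contra h
    push Not at h
    have ha := hun a h.1
    have hb := hun b h.2
    have : (1 : R) * 1 = 0 := by
      nth_rw 1 [← hab]
      rw [← hab, add_mul, mul_add, mul_add, hprod a a ha ha, hprod a b ha hb, hprod b a hb ha,
        hprod b b hb hb]
      simp
    rw [mul_one] at this
    exact hnt this
  · rintro ⟨fs, hfs, hgen⟩
    have hb : ∀ y, ∃ B : ℕ, y ∈ fs → ∃ f, Good f ∧ q f = y ∧ cp 0 f T.e = 0 ∧
        ∀ c : ℤ, B < c → cp c f = 0 := by
      intro y
      by_cases hy : y ∈ fs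
      · obtain ⟨f, hf, hq, h0⟩ := hun y (hfs y hy)
        obtain ⟨c0, h1, h2, -⟩ := gfin f hf
        refine ⟨c0.sup Int.toNat, fun _ => ⟨f, hf, hq, h0, fun c hc => h2 c fun hcm => ?_⟩⟩
        have := Finset.le_sup (f := Int.toNat) hcm
        have := h1 c hcm
        omega
      · exact ⟨0, fun h => absurd h hy⟩
    choose B hB using hb
    obtain ⟨c, f, hc, hf, hfn⟩ := T.nonvanishing (fs.sup B)
    have hc0 : 0 < c := by omega
    have gf := ghom c f hc0.le hf
    have hP : P0 (q f) := ⟨f, gf, rfl, by rw [(chom c f hf.1).2 0 hc0.ne]; rfl⟩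
    have hmem := hgen _ (hnu _ hP)
    have hQ : ∃ g, Good g ∧ q g = q f ∧ cp 0 g T.e = 0 ∧ T.Null (c - 1) (cp c g T.e) := by
      refine Submodule.span_induction (p := fun y _ => ∃ g, Good g ∧ q g = y ∧ cp 0 g T.e = 0 ∧
        T.Null (c - 1) (cp c g T.e)) ?_ ?_ ?_ ?_ hmem
      · intro y hy
        obtain ⟨g, h1, h2, h3, h4⟩ := hB y hy
        refine ⟨g, h1, h2, h3, ?_⟩
        have := Finset.le_sup (f := B) (Finset.mem_coe.1 hy)
        rw [h4 c (by omega)]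
        exact T.null_zero
      · exact ⟨0, g0, q0, by simp, by simpa using T.null_zero⟩
      · rintro _ _ - - ⟨a, a1, rfl, a3, a4⟩ ⟨b, b1, rfl, b3, b4⟩
        refine ⟨a + b, gadd _ _ a1 b1, hqadd _ _ a1 b1, by simp [a3, b3], ?_⟩
        simpa using T.null_add a4 b4
      · rintro r _ - ⟨a, a1, rfl, a3, a4⟩
        obtain ⟨l, m, hm, rfl⟩ := hdec r
        refine ⟨l • a, by rw [hsm]; exact gsm _ _ a1, ?_, ?_, ?_⟩
        · rw [hqsmul _ _ a1, smul_eq_mul, add_mul, hprod m (q a) hm ⟨a, a1, rfl, a3⟩, add_zero]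
        · rw [hsm, map_smul, LinearMap.smul_apply, a3, smul_zero]
        · rw [hsm, map_smul, LinearMap.smul_apply]
          exact T.null_smul _ a4
    obtain ⟨g, h1, h2, -, h4⟩ := hQ
    have h5 := T.null_add (nullq f g gf h1 h2.symm c) h4
    rw [sub_add_cancel, (chom c f hf.1).1] at h5
    exact hfn h5

end Part3

section Part4

/-- relative trace identity for projective modules over a group algebra -/
theorem tt_trace {k G P : Type} [Field k] [CommGroup G] [Fintype G] [AddCommGroup P] [Module k P]
    [Module (MonoidAlgebra k G) P] [IsScalarTower k (MonoidAlgebra k G) P]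
    (hP : Module.Projective (MonoidAlgebra k G) P) :
    ∃ π : P →ₗ[k] P, ∀ x, ∑ g : G, MonoidAlgebra.of k G g •
      π (MonoidAlgebra.of k G g⁻¹ • x) = x := by
  classical
  obtain ⟨s, hs⟩ := Module.projective_def'.1 hP
  let θ : MonoidAlgebra k G →ₗ[k] MonoidAlgebra k G :=
    { toFun := fun a => MonoidAlgebra.single 1 (a.coeff 1)
      map_add' := fun a b => by simp
      map_smul' := fun c a => by simp }
  have hθ : ∀ a : MonoidAlgebra k G, ∑ g : G, MonoidAlgebra.of k G g *
      θ (MonoidAlgebra.of k G g⁻¹ * a) = a := by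
    intro a
    have h1 : ∀ g : G, MonoidAlgebra.of k G g * θ (MonoidAlgebra.of k G g⁻¹ * a) =
        MonoidAlgebra.single g (a.coeff g) := by
      intro g
      show MonoidAlgebra.single g 1 * MonoidAlgebra.single 1 _ = _
      rw [MonoidAlgebra.single_mul_single]
      simp [MonoidAlgebra.of_apply]
    rw [Finset.sum_congr rfl fun g _ => h1 g]
    ext g
    simp [MonoidAlgebra.coeff_sum]
  let L : (P →₀ MonoidAlgebra k G) →ₗ[k] P := Finsupp.lsum k (fun m : P =>
    ((LinearMap.toSpanSingleton (MonoidAlgebra k G) P m).restrictScalars k) ∘ₗ θ)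
  have hL : ∀ v, ∑ g : G, MonoidAlgebra.of k G g • L (MonoidAlgebra.of k G g⁻¹ • v) =
      Finsupp.linearCombination (MonoidAlgebra k G) id v := by
    intro v
    induction v using Finsupp.induction_linear with
    | zero => simp
    | add f g hf hg => simp only [smul_add, map_add, Finset.sum_add_distrib, hf, hg]
    | single m a =>
      have : ∀ g : G, MonoidAlgebra.of k G g • L (MonoidAlgebra.of k G g⁻¹ • Finsupp.single m a) =
          (MonoidAlgebra.of k G g * θ (MonoidAlgebra.of k G g⁻¹ * a)) • m := by
        intro g
        rw [Finsupp.smul_single, smul_eq_mul]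
        simp only [L, Finsupp.lsum_single, LinearMap.comp_apply, LinearMap.restrictScalars_apply,
          LinearMap.toSpanSingleton_apply, smul_smul]
      rw [Finset.sum_congr rfl fun g _ => this g, ← Finset.sum_smul, hθ]
      simp
  refine ⟨L ∘ₗ s.restrictScalars k, fun x => ?_⟩
  simp only [LinearMap.comp_apply, LinearMap.restrictScalars_apply, map_smul s]
  rw [hL]
  exact LinearMap.congr_fun hs x

theorem tt_geom {A : Type} [CommRing A] (p : ℕ) (hp : p.Prime) [CharP A p] (x : A) :
    (x - 1) * (x - 1) ^ (p - 2) = ∑ i ∈ Finset.range p, x ^ i := by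
  have := Fact.mk hp
  have h1 : (x - 1) * (x - 1) ^ (p - 2) = (x - 1) ^ (p - 1) := by
    rw [← pow_succ']; congr 1; have := hp.two_le; omega
  rw [h1]
  have key : ((Polynomial.X : Polynomial (ZMod p)) - 1) ^ (p - 1) =
      ∑ i ∈ Finset.range p, Polynomial.X ^ i := by
    have hne : (Polynomial.X : Polynomial (ZMod p)) - 1 ≠ 0 := Polynomial.X_sub_C_ne_zero 1
    apply mul_right_cancel₀ hne
    rw [← pow_succ, Nat.sub_add_cancel hp.one_lt.le, sub_pow_char, one_pow, geom_sum_mul]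
  let _ := ZMod.algebra A p
  have := congrArg (Polynomial.aeval x) key
  simpa using this

/-- The group-theoretic input. -/
structure TTGrp (p : ℕ) (G : Type) [CommGroup G] where
  σ : Bool → G
  D : Bool → Subgroup G
  hσ : ∀ j, σ j ^ p = 1
  hσ1 : ∀ j, σ j ≠ 1
  hσD : ∀ j, σ j ∈ D (!j)
  hbij : ∀ j, Function.Bijective (fun x : Fin p × D j => σ j ^ (x.1 : ℕ) * (x.2 : G))

namespace TTGrp

theorem sum {p : ℕ} {G : Type} [CommGroup G] (Γ : TTGrp p G) [Fintype G]
    [∀ j, Fintype (Γ.D j)] {M : Type} [AddCommMonoid M] (j : Bool) (F : G → M) :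
    ∑ h : Γ.D j, ∑ n ∈ Finset.range p, F (Γ.σ j ^ n * (h : G)) = ∑ g : G, F g := by
  simp only [Finset.sum_range]
  rw [Finset.sum_comm, ← Fintype.sum_prod_type']
  exact Function.Bijective.sum_comp (Γ.hbij j) F

theorem exists_dec {p : ℕ} {G : Type} [CommGroup G] (Γ : TTGrp p G) (j : Bool) (g : G) :
    ∃ n : ℕ, ∃ h ∈ Γ.D j, g = Γ.σ j ^ n * h := by
  obtain ⟨⟨n, h⟩, hh⟩ := (Γ.hbij j).2 g
  exact ⟨n, h, h.2, hh.symm⟩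

/-- augmentation ideal -/
noncomputable def I (k G : Type) [Field k] [CommGroup G] : Ideal (MonoidAlgebra k G) :=
  Ideal.span (Set.range fun g => MonoidAlgebra.of k G g - 1)

theorem mem_I (k : Type) {G : Type} [Field k] [CommGroup G] (g : G) :
    MonoidAlgebra.of k G g - 1 ∈ I k G := Ideal.subset_span ⟨g, rfl⟩

theorem I_ind {k G : Type} [Field k] [CommGroup G] {P : MonoidAlgebra k G → Prop}
    (h1 : ∀ g, P (MonoidAlgebra.of k G g - 1))
    (h0 : P 0) (h2 : ∀ a b, P a → P b → P (a + b)) (h3 : ∀ a b, P b → P (a * b)) :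
    ∀ a ∈ I k G, P a := by
  intro a ha
  refine Submodule.span_induction (p := fun a _ => P a) ?_ h0 (fun a b _ _ => h2 a b)
    (fun a b _ => h3 a b) ha
  rintro _ ⟨g, rfl⟩
  exact h1 g

noncomputable def N (k G : Type) [Field k] [CommGroup G] [Fintype G] : MonoidAlgebra k G :=
  ∑ g : G, MonoidAlgebra.of k G g

noncomputable def DD (k : Type) {p : ℕ} {G : Type} [Field k] [CommGroup G] (Γ : TTGrp p G)
    [∀ j, Fintype (Γ.D j)] (j : Bool) : MonoidAlgebra k G :=
  ∑ h : Γ.D j, MonoidAlgebra.of k G (h : G)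

noncomputable def X (k : Type) {p : ℕ} {G : Type} [Field k] [CommGroup G] (Γ : TTGrp p G)
    (j : Bool) : MonoidAlgebra k G := MonoidAlgebra.of k G (Γ.σ j) - 1

variable {k : Type} {p : ℕ} {G : Type} [Field k] [CommGroup G]

theorem o_N [Fintype G] (g : G) : MonoidAlgebra.of k G g * N k G = N k G := by
  rw [N, Finset.mul_sum]
  exact Fintype.sum_equiv (Equiv.mulLeft g) _ _ fun h => by simp

theorem I_N [Fintype G] : ∀ a ∈ I k G, a * N k G = 0 := by
  refine I_ind (fun g => ?_) (by simp) (fun a b ha hb => ?_) (fun a b hb => ?_)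
  · rw [sub_mul, o_N, one_mul, sub_self]
  · rw [add_mul, ha, hb, add_zero]
  · rw [mul_assoc, hb, mul_zero]

variable (Γ : TTGrp p G) [∀ j, Fintype (Γ.D j)]

theorem o_D (j : Bool) {g : G} (hg : g ∈ Γ.D j) :
    MonoidAlgebra.of k G g * DD k Γ j = DD k Γ j := by
  rw [DD, Finset.mul_sum]
  exact Fintype.sum_equiv (Equiv.mulLeft (⟨g, hg⟩ : Γ.D j)) _ _ fun h => by simp

theorem o_D' (j : Bool) {g : G} (hg : g ∈ Γ.D j) :
    (MonoidAlgebra.of k G g - 1) * DD k Γ j = 0 := by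
  rw [sub_mul, o_D Γ j hg, one_mul, sub_self]

theorem charA [CharP k p] : CharP (MonoidAlgebra k G) p :=
  charP_of_injective_algebraMap (algebraMap k (MonoidAlgebra k G)).injective p

theorem XXY [CharP k p] (hp : p.Prime) (j : Bool) : X k Γ j * (X k Γ j * X k Γ j ^ (p - 2)) = 0 := by
  have := Fact.mk hp
  have := charA (k := k) (p := p) (G := G)
  have h1 : X k Γ j * (X k Γ j * X k Γ j ^ (p - 2)) = X k Γ j ^ p := by
    rw [← pow_succ', ← pow_succ']; congr 1; have := hp.two_le; omega
  rw [h1, X, sub_pow_char, ← map_pow, Γ.hσ, map_one, one_pow, sub_self]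

theorem N_eq [Fintype G] [CharP k p] (hp : p.Prime) (j : Bool) :
    N k G = X k Γ j * X k Γ j ^ (p - 2) * DD k Γ j := by
  have := charA (k := k) (p := p) (G := G)
  rw [X, tt_geom p hp, N, ← Γ.sum j, DD, Finset.sum_mul_sum, Finset.sum_comm]
  simp only [map_mul, map_pow]

theorem hc (j : Bool) : ∀ a ∈ I k G, ∃ b, a * DD k Γ j = b * (X k Γ j * DD k Γ j) := by
  refine I_ind (fun g => ?_) ⟨0, by simp⟩ ?_ ?_
  · obtain ⟨n, h, hh, rfl⟩ := Γ.exists_dec j g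
    refine ⟨∑ i ∈ Finset.range n, MonoidAlgebra.of k G (Γ.σ j) ^ i, ?_⟩
    rw [← mul_assoc, X, geom_sum_mul, sub_mul, map_mul, mul_assoc, o_D Γ j hh, map_pow, sub_mul]
  · rintro a b ⟨a', ha⟩ ⟨b', hb⟩
    exact ⟨a' + b', by rw [add_mul, ha, hb, add_mul]⟩
  · rintro a b ⟨b', hb⟩
    exact ⟨a * b', by rw [mul_assoc, hb, mul_assoc]⟩

theorem hsplit : ∀ a ∈ I k G, ∃ a1 a2, a1 ∈ I k G ∧ a2 ∈ I k G ∧ a = a1 + a2 ∧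
    a1 * DD k Γ true = 0 ∧ a2 * DD k Γ false = 0 := by
  refine I_ind (fun g => ?_) ⟨0, 0, by simp⟩ ?_ ?_
  · obtain ⟨n, h, hh, rfl⟩ := Γ.exists_dec true g
    refine ⟨MonoidAlgebra.of k G (Γ.σ true ^ n) * (MonoidAlgebra.of k G h - 1),
      MonoidAlgebra.of k G (Γ.σ true ^ n) - 1, Ideal.mul_mem_left _ _ (mem_I k _), mem_I k _,
      ?_, ?_, ?_⟩
    · rw [map_mul]; ring
    · rw [mul_assoc, o_D' Γ true hh, mul_zero]
    · exact o_D' Γ false (Subgroup.pow_mem _ (Γ.hσD true) n)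
  · rintro a b ⟨a1, a2, h1, h2, rfl, h3, h4⟩ ⟨b1, b2, h1', h2', rfl, h3', h4'⟩
    exact ⟨a1 + b1, a2 + b2, Ideal.add_mem _ h1 h1', Ideal.add_mem _ h2 h2', by ring,
      by rw [add_mul, h3, h3', add_zero], by rw [add_mul, h4, h4', add_zero]⟩
  · rintro a b ⟨b1, b2, h1', h2', rfl, h3', h4'⟩
    exact ⟨a * b1, a * b2, Ideal.mul_mem_left _ _ h1', Ideal.mul_mem_left _ _ h2', by ring,
      by rw [mul_assoc, h3', mul_zero], by rw [mul_assoc, h4', mul_zero]⟩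

theorem D_mem [CharP k p] (hp : p.Prime) (j : Bool) : DD k Γ j ∈ I k G := by
  have := Fact.mk hp
  have := charA (k := k) (p := p) (G := G)
  have h1 : p ∣ Fintype.card (Γ.D j) := by
    have hmem : Γ.σ (!j) ∈ Γ.D j := by simpa using Γ.hσD (!j)
    have h2 : orderOf (⟨Γ.σ (!j), hmem⟩ : Γ.D j) = p := by
      refine orderOf_eq_prime ?_ ?_
      · ext; simpa using Γ.hσ (!j)
      · intro h; exact Γ.hσ1 (!j) (by simpa using congrArg Subtype.val h)
    have h3 := orderOf_dvd_card (x := (⟨Γ.σ (!j), hmem⟩ : Γ.D j))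
    rwa [h2] at h3
  have h2 : DD k Γ j = ∑ h : Γ.D j, (MonoidAlgebra.of k G (h : G) - 1) := by
    rw [Finset.sum_sub_distrib, DD]
    simp [(CharP.cast_eq_zero_iff (MonoidAlgebra k G) p _).2 h1]
  rw [h2]
  exact Ideal.sum_mem _ fun h _ => mem_I k _

end TTGrp

end Part4

section Part5

theorem tt_pi {k G M : Type} [Field k] [CommGroup G] [Fintype G] [AddCommGroup M] [Module k M]
    [Module (MonoidAlgebra k G) M] [IsScalarTower k (MonoidAlgebra k G) M]
    {S : ℤ → Submodule (MonoidAlgebra k G) M} (hS : DirectSum.IsInternal S)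
    (hS' : DirectSum.IsInternal fun i => (S i).restrictScalars k)
    (hproj : ∀ i, Module.Projective (MonoidAlgebra k G) (S i)) :
    ∃ π : M →ₗ[k] M, (∀ i, ∀ x ∈ S i, π x ∈ S i) ∧
      ∀ x, ∑ g : G, MonoidAlgebra.of k G g • π (MonoidAlgebra.of k G g⁻¹ • x) = x := by
  obtain ⟨pr, h1, h2, h3⟩ := tt_pr hS
  have hex : ∀ i, ∃ π : S i →ₗ[k] S i, ∀ x, ∑ g : G, MonoidAlgebra.of k G g •
      π (MonoidAlgebra.of k G g⁻¹ • x) = x := fun i => tt_trace (hproj i)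
  choose π hπ using hex
  obtain ⟨t, ht⟩ := tt_glue hS' (fun i => ((S i).subtype.restrictScalars k) ∘ₗ π i ∘ₗ
    (((pr i).codRestrict (S i) (h1 i)).restrictScalars k))
  have ht' : ∀ i, ∀ x (hx : x ∈ S i), t x = (π i ⟨x, hx⟩ : M) := by
    intro i x hx
    rw [ht i x hx]
    have : ((pr i).codRestrict (S i) (h1 i)) x = ⟨x, hx⟩ := Subtype.ext (h2 i x hx)
    simp only [LinearMap.comp_apply, LinearMap.restrictScalars_apply, this]
    rfl
  refine ⟨t, fun i x hx => by rw [ht' i x hx]; exact Subtype.prop _, ?_⟩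
  let L : M →ₗ[k] M := ∑ g : G, (Algebra.lsmul k k M (MonoidAlgebra.of k G g)) ∘ₗ t ∘ₗ
    (Algebra.lsmul k k M (MonoidAlgebra.of k G g⁻¹))
  have hL : L = LinearMap.id := by
    refine tt_ext hS' _ _ fun i x hx => ?_
    have hx' : x ∈ S i := hx
    simp only [L, LinearMap.sum_apply, LinearMap.comp_apply, Algebra.lsmul_coe, LinearMap.id_apply]
    have := congrArg Subtype.val (hπ i ⟨x, hx'⟩)
    rw [AddSubmonoidClass.coe_finsetSum] at this
    refine Eq.trans (Finset.sum_congr rfl fun g _ => ?_) this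
    rw [ht' i _ (Submodule.smul_mem _ _ hx')]
    rfl
  intro x
  have := LinearMap.congr_fun hL x
  simpa [L, LinearMap.sum_apply] using this

theorem tt_build {k G M : Type} [Field k] [CommGroup G] [Fintype G] [AddCommGroup M] [Module k M]
    [Module (MonoidAlgebra k G) M] [IsScalarTower k (MonoidAlgebra k G) M]
    {p : ℕ} (hp : p.Prime) [CharP k p] (Γ : TTGrp p G)
    {S : ℤ → Submodule (MonoidAlgebra k G) M} (hS : DirectSum.IsInternal S)
    (hproj : ∀ i, Module.Projective (MonoidAlgebra k G) (S i))
    (d : M →ₗ[MonoidAlgebra k G] M) (hd2 : ∀ x, d (d x) = 0)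
    (hdeg : ∀ (i : ℤ), ∀ x ∈ S i, d x ∈ S (i - 1))
    (hexact : ∀ (i : ℤ), ∀ x ∈ S i, d x = 0 → ∃ y ∈ S (i + 1), d y = x)
    (e : M) (he : e ∈ S (-1)) (hne : e ≠ 0)
    (hspan : ∀ x ∈ S (-1), d x = 0 → ∃ c : k, x = c • e)
    (hinv : ∀ g, MonoidAlgebra.of k G g • e = e) (hlift : ∃ u ∈ S 0, d u = e) :
    ∃ T : TTData (MonoidAlgebra k G) M, T.S = S ∧ T.d = d ∧ T.e = e := by
  classical
  have hS' : DirectSum.IsInternal fun i => (S i).restrictScalars k := hS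
  obtain ⟨π, hπ, htr⟩ := tt_pi hS hS' hproj
  have hde : d e = 0 := by obtain ⟨u, -, rfl⟩ := hlift; exact hd2 u
  obtain ⟨σ, hσ, hσd⟩ := tt_contraction hS' (d.restrictScalars k) hd2 hdeg hexact
  let ρ : G →* Module.End k M := 
    ((Algebra.lsmul k k M : MonoidAlgebra k G →ₐ[k] Module.End k M) :
      MonoidAlgebra k G →* Module.End k M).comp (MonoidAlgebra.of k G)
  have hρ : ∀ g x, ρ g x = MonoidAlgebra.of k G g • x := fun g x => rfl
  have hinvI : ∀ x : M, (∀ a ∈ TTGrp.I k G, a • x = 0) ↔ ∀ g, MonoidAlgebra.of k G g • x = x := by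
    intro x
    constructor
    · intro h g
      have := h _ (TTGrp.mem_I k g)
      rwa [sub_smul, one_smul, sub_eq_zero] at this
    · intro h
      refine TTGrp.I_ind (fun g => ?_) (by simp) (fun a b ha hb => ?_) (fun a b hb => ?_)
      · rw [sub_smul, one_smul, h, sub_self]
      · rw [add_smul, ha, hb, add_zero]
      · rw [mul_smul, hb, smul_zero]
  refine ⟨⟨S, d, e, TTGrp.I k G, TTGrp.N k G, TTGrp.X k Γ, fun j => TTGrp.X k Γ j ^ (p - 2),
    TTGrp.DD k Γ, hd2, hdeg, he, hde, hne, (hinvI e).2 hinv, ?_, hlift, TTGrp.I_N,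
    fun j => TTGrp.mem_I k _, TTGrp.D_mem Γ hp, TTGrp.XXY Γ hp, TTGrp.N_eq Γ hp, TTGrp.hc Γ,
    TTGrp.hsplit Γ, ?_, ?_, ?_, ?_⟩, rfl, rfl, rfl⟩
  · intro x hx hdx
    obtain ⟨c, hc⟩ := hspan x hx hdx
    exact ⟨algebraMap k _ c, by rw [hc, algebraMap_smul]⟩
  · intro i x hx hi
    refine ⟨π x, hπ i x hx, ?_⟩
    have h1 := htr x
    simp only [(hinvI x).1 hi] at h1
    rw [TTGrp.N, Finset.sum_smul, h1]
  · intro i m hm h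
    have h1 := htr m
    have h2 : ∑ g : G, π (MonoidAlgebra.of k G g⁻¹ • m) = 0 := by
      rw [← map_sum, ← Finset.sum_smul]
      have : ∑ g : G, MonoidAlgebra.of k G g⁻¹ = TTGrp.N k G :=
        Fintype.sum_equiv (Equiv.inv G) _ _ fun g => rfl
      rw [this, h, map_zero]
    have h3 : m = ∑ g : G, (MonoidAlgebra.of k G g - 1) • π (MonoidAlgebra.of k G g⁻¹ • m) := by
      simp only [sub_smul, one_smul]
      rw [Finset.sum_sub_distrib, h1, h2, sub_zero]
    rw [h3]
    exact Submodule.sum_mem _ fun g _ => Submodule.smul_mem_smul (TTGrp.mem_I k g)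
      (hπ i _ (Submodule.smul_mem _ _ hm))
  · intro c ε hε φ hφ hφd z hz hzi hdz
    obtain ⟨s, s1, s2, s3, s4⟩ := tt_L1 ρ hS' (fun g i x hx => Submodule.smul_mem (S i) _ hx)
      (d.restrictScalars k) hd2 hdeg (fun g x => map_smul d _ _) σ hσ hσd π hπ htr e he hne hspan
      hinv hde c ε hε (φ.restrictScalars k) hφ (fun g x => map_smul φ _ _) hφd z hz
      ((hinvI z).1 hzi) hdz
    exact ⟨MonoidAlgebra.equivariantOfLinearOfComm s s1, s2, s3, s4⟩
  · intro j c φ hφ hφd m hm hφe n x hx hi hdx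
    let πD : M →ₗ[k] M := ∑ n ∈ Finset.range p, (ρ (Γ.σ j ^ n)) ∘ₗ π ∘ₗ (ρ (Γ.σ j ^ n)⁻¹)
    have hπD : ∀ x, πD x = ∑ n ∈ Finset.range p, ρ (Γ.σ j ^ n) (π (ρ (Γ.σ j ^ n)⁻¹ x)) := by
      intro x; simp [πD, LinearMap.sum_apply]
    have hπDS : ∀ i, ∀ x ∈ S i, πD x ∈ S i := by
      intro i x hx
      rw [hπD]
      exact Submodule.sum_mem _ fun n _ => Submodule.smul_mem _ _
        (hπ i _ (Submodule.smul_mem _ _ hx))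
    let ρD : Γ.D j →* Module.End k M := ρ.comp (Γ.D j).subtype
    have htrD : ∀ x, ∑ h : Γ.D j, ρD h (πD (ρD h⁻¹ x)) = x := by
      intro x
      refine Eq.trans ?_ (htr x)
      rw [← Γ.sum j]
      refine Finset.sum_congr rfl fun h _ => ?_
      rw [hπD, map_sum]
      refine Finset.sum_congr rfl fun n _ => ?_
      simp only [ρD, hρ, MonoidHom.comp_apply, Subgroup.subtype_apply, smul_smul, ← map_mul,
        mul_inv_rev, Subgroup.coe_inv]
      rw [mul_comm (h : G), mul_comm (h : G)⁻¹]
    have hzD : ∀ h : Γ.D j, ρD h (TTGrp.DD k Γ j • m) = TTGrp.DD k Γ j • m := by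
      intro h
      show MonoidAlgebra.of k G (h : G) • TTGrp.DD k Γ j • m = TTGrp.DD k Γ j • m
      rw [smul_smul, TTGrp.o_D Γ j h.2]
    obtain ⟨s, s1, s2, s3, s4⟩ := tt_L1 ρD hS' (fun g i x hx => Submodule.smul_mem (S i) _ hx)
      (d.restrictScalars k) hd2 hdeg (fun g x => map_smul d _ _) σ hσ hσd πD hπDS htrD e he hne
      hspan (fun h => hinv h) hde c 1 (by norm_num) (φ.restrictScalars k) hφ
      (fun g x => map_smul φ _ _) (fun x => by simpa using hφd x) (TTGrp.DD k Γ j • m)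
      (Submodule.smul_mem (S c) _ hm) hzD hφe.symm
    refine ⟨πD (s x), hπDS _ _ (s2 n x hx), ?_⟩
    have h1 := s3 x
    simp only [LinearMap.restrictScalars_apply, hdx, map_zero, smul_zero, add_zero] at h1
    rw [← h1]
    congr 1
    have h2 := htrD (s x)
    have h3 : ∀ h : Γ.D j, ρD h (s x) = s x := by
      intro h
      rw [← s1]
      congr 1
      exact (hinvI x).1 hi h
    simp only [h3] at h2
    rw [TTGrp.DD, Finset.sum_smul]
    exact h2.symm

theorem tt_group (p : ℕ) (hp : p.Prime) (r : ℕ) (hr : 2 ≤ r) :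
    Nonempty (TTGrp p (Multiplicative (Fin r → ZMod p))) := by
  classical
  have := Fact.mk hp
  let ix : Bool → Fin r := fun j => if j then ⟨0, by omega⟩ else ⟨1, by omega⟩
  have hix : ∀ j, ix (!j) ≠ ix j := by intro j; cases j <;> simp [ix, Fin.ext_iff]
  let D : Bool → Subgroup (Multiplicative (Fin r → ZMod p)) := fun j =>
    { carrier := {g | Multiplicative.toAdd g (ix j) = 0}
      mul_mem' := fun {a b} ha hb => by
        simp only [Set.mem_ofPred_eq] at *
        simp [ha, hb]
      one_mem' := by simp
      inv_mem' := fun {a} ha => by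
        simp only [Set.mem_ofPred_eq] at *
        simp [ha] }
  have hD : ∀ j g, g ∈ D j ↔ Multiplicative.toAdd g (ix j) = 0 := fun j g => Iff.rfl
  let σ : Bool → Multiplicative (Fin r → ZMod p) := fun j =>
    Multiplicative.ofAdd (Pi.single (ix j) 1)
  have hpow : ∀ j (n : ℕ), Multiplicative.toAdd (σ j ^ n) (ix j) = n := by
    intro j n; simp [σ]
  refine ⟨⟨σ, D, fun j => ?_, fun j h => ?_, fun j => ?_, fun j => ⟨?_, ?_⟩⟩⟩
  · apply Multiplicative.toAdd.injective
    ext i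
    simp [σ]
  · have := congrFun (congrArg Multiplicative.toAdd h) (ix j)
    simp [σ] at this
  · rw [hD]
    simp [σ, hix]
  · rintro ⟨n, h, hh⟩ ⟨n', h', hh'⟩ heq
    simp only at heq
    have h1 := congrFun (congrArg Multiplicative.toAdd heq) (ix j)
    rw [hD] at hh hh'
    simp only [toAdd_mul, Pi.add_apply, hpow, hh, hh', add_zero] at h1
    rw [ZMod.natCast_eq_natCast_iff'] at h1
    rw [Nat.mod_eq_of_lt n.2, Nat.mod_eq_of_lt n'.2] at h1
    have h2 : n = n' := Fin.ext h1
    subst h2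
    simpa using heq
  · intro g
    refine ⟨⟨⟨(Multiplicative.toAdd g (ix j)).val, ZMod.val_lt _⟩,
      ⟨(σ j ^ (Multiplicative.toAdd g (ix j)).val)⁻¹ * g, ?_⟩⟩, ?_⟩
    · rw [hD]
      simp only [toAdd_mul, toAdd_inv, Pi.add_apply, Pi.neg_apply, hpow]
      simp
    · simp

end Part5

/-- Let `k` be a field of characteristic `p` and `E` an elementary
abelian `p`-group of order at least `p²` (rank `r ≥ 2`).  Then the non-positive
part `R = Ĥ^{≤0}(E, k)` of the Tate cohomology ring is a local `k`-algebra whose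
maximal ideal `m = Ĥ^{<0}(E, k)` (the set of non-units) satisfies `m² = 0` and is
not finitely generated as an ideal.

Tate cohomology is modelled on a complete resolution `(Mbig, S, d, ε)` of the
trivial module: `Ĥ^{≤0}` is the ring of chain endomorphisms which are finite sums
of homogeneous components raising the grading by `c ≥ 0`, taken modulo
null-homotopic maps.  `R` is presented as any ring quotient `q` of this
endomorphism ring whose kernel consists exactly of the null-homotopic maps. -/
theorem nonpositive_tate_cohomology_ring_local_radical_square_zero
    (k : Type) [Field k] (p : ℕ) (hp : p.Prime) [CharP k p]
    (r : ℕ) (hr : 2 ≤ r)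
    (T : Type) [AddCommGroup T] [Module k T]
    [Module (MonoidAlgebra k (Multiplicative (Fin r → ZMod p))) T]
    [IsScalarTower k (MonoidAlgebra k (Multiplicative (Fin r → ZMod p))) T]
    (e0 : T ≃ₗ[k] k)
    (htriv : ∀ (g : Multiplicative (Fin r → ZMod p)) (t : T),
      (MonoidAlgebra.single g (1 : k) :
        MonoidAlgebra k (Multiplicative (Fin r → ZMod p))) • t = t)
    -- a complete resolution of `T`
    (Mbig : Type) [AddCommGroup Mbig] [Module k Mbig]
    [Module (MonoidAlgebra k (Multiplicative (Fin r → ZMod p))) Mbig]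
    [IsScalarTower k (MonoidAlgebra k (Multiplicative (Fin r → ZMod p))) Mbig]
    [SMulCommClass k (MonoidAlgebra k (Multiplicative (Fin r → ZMod p))) Mbig]
    (S : ℤ → Submodule (MonoidAlgebra k (Multiplicative (Fin r → ZMod p))) Mbig)
    (hinternal : DirectSum.IsInternal S)
    (hproj : ∀ i, Module.Projective
      (MonoidAlgebra k (Multiplicative (Fin r → ZMod p))) (S i))
    (d : Mbig →ₗ[MonoidAlgebra k (Multiplicative (Fin r → ZMod p))] Mbig)
    (hd2 : d ∘ₗ d = 0)
    (hdeg : ∀ (i : ℤ), ∀ x ∈ S i, d x ∈ S (i - 1))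
    (hexact : ∀ (i : ℤ), ∀ x ∈ S i, d x = 0 → ∃ y ∈ S (i + 1), d y = x)
    (ε : Mbig →ₗ[MonoidAlgebra k (Multiplicative (Fin r → ZMod p))] T)
    (hεd : ε ∘ₗ d = 0)
    (hεout : ∀ (i : ℤ), i ≠ 0 → ∀ x ∈ S i, ε x = 0)
    (hεsurj : ∀ t : T, ∃ x ∈ S 0, ε x = t)
    (hεker : ∀ x ∈ S 0, ε x = 0 → ∃ y ∈ S 1, d y = x)
    -- `R = Ĥ^{≤0}(E, k)`, presented as a quotient of the ring of chain
    -- endomorphisms of non-negative (homological) degree by the null-homotopic ones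
    (R : Type) [Ring R] [Algebra k R]
    (q : (Mbig →ₗ[MonoidAlgebra k (Multiplicative (Fin r → ZMod p))] Mbig) → R)
    (Good : (Mbig →ₗ[MonoidAlgebra k (Multiplicative (Fin r → ZMod p))] Mbig) → Prop)
    (hGood : ∀ f, Good f ↔
      (f ∘ₗ d = d ∘ₗ f ∧
        ∃ (c0 : Finset ℤ)
          (F : ℤ → (Mbig →ₗ[MonoidAlgebra k (Multiplicative (Fin r → ZMod p))] Mbig)),
          (∀ c ∈ c0, 0 ≤ c) ∧
          (∀ c ∈ c0, ∀ (i : ℤ), ∀ x ∈ S i, F c x ∈ S (i + c)) ∧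
          f = ∑ c ∈ c0, F c))
    (hq1 : q 1 = 1)
    (hqadd : ∀ f g, Good f → Good g → q (f + g) = q f + q g)
    (hqmul : ∀ f g, Good f → Good g → q (f ∘ₗ g) = q f * q g)
    (hqsmul : ∀ (c : k) (f), Good f → q (c • f) = algebraMap k R c * q f)
    (hqsurj : ∀ y : R, ∃ f, Good f ∧ q f = y)
    (hqker : ∀ f g, Good f → Good g →
      (q f = q g ↔ ∃ s : Mbig →ₗ[MonoidAlgebra k (Multiplicative (Fin r → ZMod p))] Mbig,
        (∀ (i : ℤ), ∀ x ∈ S i, s x ∈ ⨆ (j : ℤ) (_ : i + 1 ≤ j), S j) ∧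
        f - g = d ∘ₗ s + s ∘ₗ d)) :
    -- `R` is local, its maximal ideal (the non-units) squares to zero,
    -- and that ideal is not finitely generated
    IsLocalRing R ∧
    (∀ x y : R, ¬IsUnit x → ¬IsUnit y → x * y = 0) ∧
    ¬∃ fs : Finset R, (∀ x ∈ fs, ¬IsUnit x) ∧
      (∀ x : R, ¬IsUnit x → x ∈ Ideal.span (fs : Set R)) := by
  have := Fact.mk hp
  have hd2' : ∀ x, d (d x) = 0 := fun x => LinearMap.congr_fun hd2 x
  have hεd' : ∀ x, ε (d x) = 0 := fun x => LinearMap.congr_fun hεd x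
  obtain ⟨Γ⟩ := tt_group p hp r hr
  obtain ⟨u, hu, hεu⟩ := hεsurj (e0.symm 1)
  have hdu : d u ∈ S (-1) := by simpa using hdeg 0 u hu
  have hεk : ∀ (c : k) (x : Mbig), ε (c • x) = c • ε x := by
    intro c x
    rw [← algebraMap_smul (MonoidAlgebra k (Multiplicative (Fin r → ZMod p))) c x, map_smul,
      algebraMap_smul]
  have hdk : ∀ (c : k) (x : Mbig), d (c • x) = c • d x := by
    intro c x
    rw [← algebraMap_smul (MonoidAlgebra k (Multiplicative (Fin r → ZMod p))) c x, map_smul,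
      algebraMap_smul]
  have hker : ∀ x ∈ S 0, ε x = 0 → d x = 0 := by
    intro x hx h
    obtain ⟨y, -, rfl⟩ := hεker x hx h
    exact hd2' y
  have hne : d u ≠ 0 := by
    intro h
    obtain ⟨v, -, rfl⟩ := hexact 0 u hu h
    rw [hεd'] at hεu
    have := congrArg e0 hεu
    simp at this
  have hspan : ∀ x ∈ S (-1), d x = 0 → ∃ c : k, x = c • d u := by
    intro x hx hdx
    obtain ⟨y, hy, rfl⟩ := hexact (-1) x hx hdx
    have hy0 : y ∈ S 0 := by simpa using hy
    have hcu : (e0 (ε y)) • u ∈ S 0 := by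
      rw [← algebraMap_smul (MonoidAlgebra k (Multiplicative (Fin r → ZMod p)))]
      exact Submodule.smul_mem _ _ hu
    refine ⟨e0 (ε y), ?_⟩
    have h1 := hker (y - (e0 (ε y)) • u) (Submodule.sub_mem _ hy0 hcu) (by
      rw [map_sub, hεk, hεu, ← map_smul]
      simp)
    rw [map_sub, hdk, sub_eq_zero] at h1
    exact h1
  have hinv : ∀ g, MonoidAlgebra.of k (Multiplicative (Fin r → ZMod p)) g • d u = d u := by
    intro g
    have h1 := hker (MonoidAlgebra.of k (Multiplicative (Fin r → ZMod p)) g • u - u)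
      (Submodule.sub_mem _ (Submodule.smul_mem _ _ hu) hu) (by
        rw [map_sub, map_smul, MonoidAlgebra.of_apply, htriv, sub_self])
    rw [map_sub, map_smul, sub_eq_zero] at h1
    exact h1
  obtain ⟨T', hTS, hTd, hTe⟩ := tt_build hp Γ hinternal hproj d hd2' hdeg hexact (d u) hdu hne hspan
    hinv ⟨u, hu, rfl⟩
  subst hTS hTd
  exact tt_conclude T' hinternal (by rw [hTe]; exact hspan) q Good hGood hq1 hqadd hqmul hqsmul
    hqsurj hqker
end
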